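/- arXiv:2007.09498 — 6 statements merged into one kernel-verified Lean document; each statement's English description precedes it below -/
import Mathlib

section
/- For every ε > 0 there exists Λ < 0 such that for every λ ≤ Λ and every Dirichlet weak solution u of (P_λ) with u(x) > 0 for every x ∈ Ω_a^+, one has ∫_Ω (‖∇u‖^p + u^p) < ε. (That is, the solutions positive on Ω_a^+ tend to 0 in W^{1,p}-norm as λ → −∞.) -/
open MeasureTheory RealInnerProductSpace

noncomputable section

/-- A test function: smooth, compactly supported, with support contained in `Ω`. -/
def IsTestFun {N : ℕ} (Ω : Set (EuclideanSpace ℝ (Fin N)))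
    (φ : EuclideanSpace ℝ (Fin N) → ℝ) : Prop :=
  ContDiff ℝ (⊤ : ℕ∞) φ ∧ HasCompactSupport φ ∧ tsupport φ ⊆ Ω

/-- A Dirichlet weak solution of `(P_λ)` with exponent `q` and weight `a`:
continuous on the closure of `Ω`, continuously differentiable in `Ω`, nonnegative in `Ω`,
vanishing on the boundary, with `∫_Ω ‖∇u‖^p < ∞`, satisfying the weak form of
`-Δ_p u = λ u^{p-1} + a u^{q-1}`. -/
def DirichletSol {N : ℕ} (Ω : Set (EuclideanSpace ℝ (Fin N))) (p q lam : ℝ)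
    (a u : EuclideanSpace ℝ (Fin N) → ℝ) : Prop :=
  ContinuousOn u (closure Ω) ∧
  (∀ x ∈ Ω, DifferentiableAt ℝ u x) ∧
  ContinuousOn (fun x => gradient u x) Ω ∧
  (∀ x ∈ Ω, 0 ≤ u x) ∧
  (∀ x ∈ frontier Ω, u x = 0) ∧
  IntegrableOn (fun x => ‖gradient u x‖ ^ p) Ω ∧
  ∀ φ : EuclideanSpace ℝ (Fin N) → ℝ, IsTestFun Ω φ →
    (∫ x in Ω, ‖gradient u x‖ ^ (p - 2) * ⟪gradient u x, gradient φ x⟫)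
      = ∫ x in Ω, (lam * u x ^ (p - 1) + a x * u x ^ (q - 1)) * φ x

/-- `λ₁`: the infimum of `∫_Ω ‖∇φ‖^p` over test functions normalized in `L^p`. -/
def lambda1 {N : ℕ} (Ω : Set (EuclideanSpace ℝ (Fin N))) (p : ℝ) : ℝ :=
  sInf { E : ℝ | ∃ φ : EuclideanSpace ℝ (Fin N) → ℝ, IsTestFun Ω φ ∧
    (∫ x in Ω, |φ x| ^ p) = 1 ∧ E = ∫ x in Ω, ‖gradient φ x‖ ^ p }

/-- `λ*(a,r)`: the infimum of `∫_Ω ‖∇φ‖^p` over normalized test functions with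
`∫_Ω a |φ|^r ≥ 0`. -/
def lambdaStar {N : ℕ} (Ω : Set (EuclideanSpace ℝ (Fin N))) (p r : ℝ)
    (a : EuclideanSpace ℝ (Fin N) → ℝ) : ℝ :=
  sInf { E : ℝ | ∃ φ : EuclideanSpace ℝ (Fin N) → ℝ, IsTestFun Ω φ ∧
    (∫ x in Ω, |φ x| ^ p) = 1 ∧ (0 ≤ ∫ x in Ω, a x * |φ x| ^ r) ∧
    E = ∫ x in Ω, ‖gradient φ x‖ ^ p }

open Filter Set Metric Topology Function ContinuousLinearMap
open scoped Convolution

/-- A compactly supported `C¹` function is approximated by smooth functions supported in a small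
thickening, with bounded pointwise convergence of values and derivatives. -/
theorem exists_smooth_approx_of_contDiff_one {N : ℕ} {Ω : Set (EuclideanSpace ℝ (Fin N))}
    (hΩ : IsOpen Ω) {w : EuclideanSpace ℝ (Fin N) → ℝ} (hw : ContDiff ℝ 1 w)
    (hwc : HasCompactSupport w) (hwΩ : tsupport w ⊆ Ω) :
    ∃ (K : Set (EuclideanSpace ℝ (Fin N))) (C : ℝ) (φ : ℕ → EuclideanSpace ℝ (Fin N) → ℝ),
      IsCompact K ∧ K ⊆ Ω ∧ (∀ n, IsTestFun Ω (φ n)) ∧ (∀ n, ∀ x ∉ K, φ n x = 0) ∧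
      (∀ n, ∀ x ∉ K, fderiv ℝ (φ n) x = 0) ∧
      (∀ n x, |φ n x| ≤ C) ∧ (∀ n x, ‖fderiv ℝ (φ n) x‖ ≤ C) ∧
      (∀ x, Tendsto (fun n => φ n x) atTop (𝓝 (w x))) ∧
      (∀ x, Tendsto (fun n => fderiv ℝ (φ n) x) atTop (𝓝 (fderiv ℝ w x))) := by
  obtain ⟨r, hr, hrΩ⟩ := IsCompact.exists_cthickening_subset_open hwc hΩ hwΩ
  have hdc : Continuous (fderiv ℝ w) := hw.continuous_fderiv one_ne_zero
  obtain ⟨C₁, hC₁⟩ := hwc.exists_bound_of_continuous hw.continuous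
  obtain ⟨C₂, hC₂⟩ := (hwc.fderiv ℝ).exists_bound_of_continuous hdc
  let ρ : ℕ → ContDiffBump (0 : EuclideanSpace ℝ (Fin N)) := fun n =>
    ⟨r / (n + 1) / 2, r / (n + 1), by positivity, half_lt_self (by positivity)⟩
  have hρr : ∀ n, (ρ n).rOut ≤ r := fun n => div_le_self hr.le (by simp)
  have hρ : Tendsto (fun n => (ρ n).rOut) atTop (𝓝 0) := by
    have := (tendsto_one_div_add_atTop_nhds_zero_nat (𝕜 := ℝ)).const_mul r
    simpa [ρ, div_eq_mul_inv] using this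
  let φ : ℕ → EuclideanSpace ℝ (Fin N) → ℝ := fun n =>
    (ρ n).normed volume ⋆[lsmul ℝ ℝ, volume] w
  have hfd : ∀ n x, fderiv ℝ (φ n) x =
      ((ρ n).normed volume ⋆[lsmul ℝ ℝ, volume] fderiv ℝ w) x := by
    intro n x
    exact (hwc.hasFDerivAt_convolution_right (lsmul ℝ ℝ)
      (ρ n).continuous_normed.locallyIntegrable hw x).fderiv
  have hsupp : ∀ n, support (φ n) ⊆ cthickening r (tsupport w) := by
    intro n x hx
    obtain ⟨y, hy, z, hz, rfl⟩ := support_convolution_subset (L := lsmul ℝ ℝ) hx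
    rw [(ρ n).support_normed_eq] at hy
    refine mem_cthickening_of_dist_le _ z r _ (subset_tsupport _ hz) ?_
    simpa using (mem_ball_zero_iff.1 hy).le.trans (hρr n)
  have hts : ∀ n, tsupport (φ n) ⊆ cthickening r (tsupport w) := fun n =>
    closure_minimal (hsupp n) isClosed_cthickening
  have hK : IsCompact (cthickening r (tsupport w)) := IsCompact.cthickening hwc
  refine ⟨cthickening r (tsupport w), max (3 * C₁) (3 * C₂), φ, hK, hrΩ, fun n => ⟨?_, ?_, ?_⟩,
    ?_, ?_, ?_, ?_, ?_, ?_⟩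
  · exact (ρ n).hasCompactSupport_normed.contDiff_convolution_left _ (ρ n).contDiff_normed
      hw.continuous.locallyIntegrable
  · exact hK.of_isClosed_subset (isClosed_tsupport _) (hts n)
  · exact (hts n).trans hrΩ
  · exact fun n x hx => notMem_support.1 fun h => hx (hsupp n h)
  · exact fun n x hx => notMem_support.1 fun h => hx (hts n (support_fderiv_subset ℝ h))
  · intro n x
    refine le_trans ?_ (le_max_left _ _)
    have h := (ρ n).dist_normed_convolution_le (μ := volume) (x₀ := x) (ε := 2 * C₁)
      hw.continuous.aestronglyMeasurable
      (fun y _ => (dist_le_norm_add_norm _ _).trans (by linarith [hC₁ x, hC₁ y]))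
    have h2 := norm_sub_norm_le (φ n x) (w x)
    rw [dist_eq_norm] at h
    rw [← Real.norm_eq_abs]
    linarith [hC₁ x]
  · intro n x
    refine le_trans ?_ (le_max_right _ _)
    have h := (ρ n).dist_normed_convolution_le (μ := volume) (x₀ := x) (ε := 2 * C₂)
      hdc.aestronglyMeasurable
      (fun y _ => (dist_le_norm_add_norm _ _).trans (by linarith [hC₂ x, hC₂ y]))
    rw [← hfd, dist_eq_norm] at h
    have h2 := norm_sub_norm_le (fderiv ℝ (φ n) x) (fderiv ℝ w x)
    linarith [hC₂ x]
  · exact fun x => ContDiffBump.convolution_tendsto_right_of_continuous hρ hw.continuous x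
  · intro x
    simp_rw [hfd]
    exact ContDiffBump.convolution_tendsto_right_of_continuous hρ hdc x

/-- A weak identity that holds for smooth test functions holds for compactly supported `C¹`
functions. -/
theorem weak_identity_of_contDiff_one {N : ℕ} {Ω : Set (EuclideanSpace ℝ (Fin N))}
    (hΩ : IsOpen Ω) {F : EuclideanSpace ℝ (Fin N) → EuclideanSpace ℝ (Fin N)}
    {h : EuclideanSpace ℝ (Fin N) → ℝ}
    (hF : ∀ K ⊆ Ω, IsCompact K → IntegrableOn F K) (hh : ∀ K ⊆ Ω, IsCompact K → IntegrableOn h K)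
    (hweak : ∀ φ, IsTestFun Ω φ → ∫ x in Ω, fderiv ℝ φ x (F x) = ∫ x in Ω, h x * φ x)
    {w : EuclideanSpace ℝ (Fin N) → ℝ} (hw : ContDiff ℝ 1 w)
    (hwc : HasCompactSupport w) (hwΩ : tsupport w ⊆ Ω) :
    ∫ x in Ω, fderiv ℝ w x (F x) = ∫ x in Ω, h x * w x := by
  obtain ⟨K, C, φ, hK, hKΩ, hφ, hφK, hdφK, hφC, hdφC, hlim, hdlim⟩ :=
    exists_smooth_approx_of_contDiff_one hΩ hw hwc hwΩ
  have hwK : ∀ x ∉ K, w x = 0 := fun x hx =>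
    tendsto_nhds_unique (hlim x) (by simp [hφK _ x hx])
  have hdwK : ∀ x ∉ K, fderiv ℝ w x = 0 := fun x hx =>
    tendsto_nhds_unique (hdlim x) (by simp [hdφK _ x hx])
  have key : ∀ v : EuclideanSpace ℝ (Fin N) → ℝ, (∀ x ∉ K, v x = 0) →
      ∫ x in Ω, v x = ∫ x in K, v x := fun v hv =>
    setIntegral_eq_of_subset_of_forall_sdiff_eq_zero hΩ.measurableSet hKΩ
      (fun x hx => hv x hx.2)
  have hFK := hF K hKΩ hK
  have hhK := hh K hKΩ hK
  have h1 : Tendsto (fun n => ∫ x in K, fderiv ℝ (φ n) x (F x)) atTop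
      (𝓝 (∫ x in K, fderiv ℝ w x (F x))) := by
    refine tendsto_integral_of_dominated_convergence (fun x => C * ‖F x‖) (fun n => ?_)
      (hFK.norm.const_mul C) (fun n => ae_of_all _ fun x => ?_) (ae_of_all _ fun x => ?_)
    · have hc : Continuous (fderiv ℝ (φ n)) :=
        (hφ n).1.continuous_fderiv (by simp)
      exact isBoundedBilinearMap_apply.continuous.comp_aestronglyMeasurable
        (hc.aestronglyMeasurable.prodMk hFK.aestronglyMeasurable)
    · exact ((fderiv ℝ (φ n) x).le_opNorm _).trans (by gcongr; exact hdφC n x)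
    · exact (ContinuousLinearMap.apply ℝ ℝ (F x)).continuous.continuousAt.tendsto.comp (hdlim x)
  have h2 : Tendsto (fun n => ∫ x in K, h x * φ n x) atTop (𝓝 (∫ x in K, h x * w x)) := by
    refine tendsto_integral_of_dominated_convergence (fun x => ‖h x‖ * C) (fun n => ?_)
      (hhK.norm.mul_const C) (fun n => ae_of_all _ fun x => ?_) (ae_of_all _ fun x => ?_)
    · exact hhK.aestronglyMeasurable.mul (hφ n).1.continuous.aestronglyMeasurable
    · rw [norm_mul]; gcongr; exact hφC n x
    · exact (hlim x).const_mul _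
  rw [key _ fun x hx => by simp [hdwK x hx], key _ fun x hx => by simp [hwK x hx]]
  refine tendsto_nhds_unique h1 (h2.congr fun n => ?_)
  have := hweak _ (hφ n)
  rw [key _ fun x hx => by simp [hdφK n x hx], key _ fun x hx => by simp [hφK n x hx]] at this
  exact this.symm

/-- `C¹` truncations of the identity that vanish near zero. -/
theorem exists_contDiff_truncations :
    ∃ (G g : ℕ → ℝ → ℝ) (δ : ℕ → ℝ), (∀ n, 0 < δ n) ∧ (∀ n t, HasDerivAt (G n) (g n t) t) ∧
      (∀ n, Continuous (g n)) ∧ (∀ n t, 0 ≤ g n t) ∧ (∀ n t, g n t ≤ 1) ∧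
      (∀ n, ∀ t ≤ δ n, G n t = 0) ∧ (∀ n, ∀ t, 0 ≤ t → |G n t| ≤ t) ∧
      (∀ t, 0 < t → Tendsto (fun n => g n t) atTop (𝓝 1)) ∧
      (∀ t, 0 ≤ t → Tendsto (fun n => G n t) atTop (𝓝 t)) := by
  let δ : ℕ → ℝ := fun n => 1 / ((n : ℝ) + 1)
  have hδ : ∀ n, 0 < δ n := fun n => by positivity
  have hδ0 : Tendsto δ atTop (𝓝 0) := tendsto_one_div_add_atTop_nhds_zero_nat
  let g : ℕ → ℝ → ℝ := fun n t => 1 - δ n / max t (δ n)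
  have hmax : ∀ n t, 0 < max t (δ n) := fun n t => lt_max_of_lt_right (hδ n)
  have hgc : ∀ n, Continuous (g n) := fun n =>
    continuous_const.sub (continuous_const.div (by fun_prop) fun t => (hmax n t).ne')
  have hg0 : ∀ n t, 0 ≤ g n t := fun n t =>
    sub_nonneg.2 ((div_le_one (hmax n t)).2 (le_max_right _ _))
  have hg1 : ∀ n t, g n t ≤ 1 := fun n t =>
    sub_le_self _ (div_nonneg (hδ n).le (hmax n t).le)
  have hgz : ∀ n, ∀ t ≤ δ n, g n t = 0 := fun n t ht => by
    simp [g, max_eq_right ht, (hδ n).ne']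
  have hglim : ∀ t, 0 < t → Tendsto (fun n => g n t) atTop (𝓝 1) := fun t ht => by
    have h : Tendsto (fun n => max t (δ n)) atTop (𝓝 (max t 0)) := tendsto_const_nhds.max hδ0
    rw [max_eq_left ht.le] at h
    simpa using (hδ0.div h ht.ne').const_sub 1
  refine ⟨fun n t => ∫ s in (0 : ℝ)..t, g n s, g, δ, hδ, fun n t => ?_, hgc, hg0, hg1,
    fun n t ht => ?_, fun n t ht => ?_, hglim, fun t ht => ?_⟩
  · exact (hgc n).integral_hasStrictDerivAt 0 t |>.hasDerivAt
  · change ∫ s in (0 : ℝ)..t, g n s = 0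
    rw [intervalIntegral.integral_congr (g := fun _ => (0 : ℝ))]
    · simp
    · exact fun s hs => hgz n s (hs.2.trans (max_le (hδ n).le ht))
  · have := intervalIntegral.norm_integral_le_of_norm_le_const (a := 0) (b := t) (f := g n) (C := 1)
      (fun s _ => by rw [Real.norm_eq_abs, abs_of_nonneg (hg0 n s)]; exact hg1 n s)
    simpa [abs_of_nonneg ht] using this
  · have : Tendsto (fun n => ∫ s in (0 : ℝ)..t, g n s) atTop (𝓝 (∫ _ in (0 : ℝ)..t, (1 : ℝ))) := by
      refine intervalIntegral.tendsto_integral_filter_of_dominated_convergence (fun _ => 1)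
        (Eventually.of_forall fun n => (hgc n).aestronglyMeasurable)
        (Eventually.of_forall fun n => ae_of_all _ fun s _ => ?_)
        intervalIntegrable_const (ae_of_all _ fun s hs => hglim s ?_)
      · rw [Real.norm_eq_abs, abs_of_nonneg (hg0 n s)]; exact hg1 n s
      · rw [uIoc_of_le ht] at hs; exact hs.1
    simpa using this

/-- Composing `u` with a `C¹` function vanishing near `(-∞, 0]` and extending by zero yields a
`C¹` function with compact support in `Ω`. -/
theorem contDiff_one_indicator_comp {N : ℕ} {Ω : Set (EuclideanSpace ℝ (Fin N))}
    (hΩo : IsOpen Ω) (hΩb : Bornology.IsBounded Ω) {u : EuclideanSpace ℝ (Fin N) → ℝ}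
    (huc : ContinuousOn u (closure Ω)) (hu1 : ContDiffOn ℝ 1 u Ω)
    (hub : ∀ x ∈ frontier Ω, u x = 0) {G : ℝ → ℝ} (hG : ContDiff ℝ 1 G) {δ : ℝ} (hδ : 0 < δ)
    (hGδ : ∀ t ≤ δ, G t = 0) :
    ContDiff ℝ 1 (Ω.indicator (G ∘ u)) ∧ HasCompactSupport (Ω.indicator (G ∘ u)) ∧
      tsupport (Ω.indicator (G ∘ u)) ⊆ Ω := by
  have hcl : IsClosed (closure Ω ∩ u ⁻¹' Ici δ) :=
    huc.preimage_isClosed_of_isClosed isClosed_closure isClosed_Ici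
  have hts : tsupport (Ω.indicator (G ∘ u)) ⊆ closure Ω ∩ u ⁻¹' Ici δ := by
    refine closure_minimal (fun x hx => ?_) hcl
    have hxΩ : x ∈ Ω := by
      by_contra h
      exact hx (indicator_of_notMem h _)
    refine ⟨subset_closure hxΩ, ?_⟩
    by_contra h
    exact hx (by rw [indicator_of_mem hxΩ]; exact hGδ _ (not_le.1 h).le)
  have hKΩ : closure Ω ∩ u ⁻¹' Ici δ ⊆ Ω := by
    rintro x ⟨hx, hxδ⟩
    by_contra h
    have h0 := hub x (by rw [hΩo.frontier_eq]; exact ⟨hx, h⟩)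
    rw [mem_preimage, h0, mem_Ici] at hxδ
    exact hδ.not_ge hxδ
  refine ⟨contDiff_iff_contDiffAt.2 fun x => ?_, ?_, hts.trans hKΩ⟩
  · by_cases hx : x ∈ Ω
    · have h1 : ContDiffAt ℝ 1 (G ∘ u) x :=
        hG.contDiffAt.comp x (hu1.contDiffAt (hΩo.mem_nhds hx))
      refine h1.congr_of_eventuallyEq ?_
      filter_upwards [hΩo.mem_nhds hx] with y hy using indicator_of_mem hy _
    · have : x ∉ tsupport (Ω.indicator (G ∘ u)) := fun h => hx (hKΩ (hts h))
      exact contDiffAt_const.congr_of_eventuallyEq (notMem_tsupport_iff_eventuallyEq.1 this)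
  · exact (hΩb.isCompact_closure.of_isClosed_subset hcl inter_subset_left).of_isClosed_subset
      (isClosed_tsupport _) hts

/-- The gradient represents the derivative through the inner product. -/
theorem inner_gradient_eq_fderiv {N : ℕ} (v x : EuclideanSpace ℝ (Fin N))
    (φ : EuclideanSpace ℝ (Fin N) → ℝ) : ⟪v, gradient φ x⟫ = fderiv ℝ φ x v := by
  rw [real_inner_comm, gradient, InnerProductSpace.toDual_symm_apply]

/-- A Dirichlet weak solution may be used as a test function in its own equation. -/
theorem DirichletSol.energy_identity {N : ℕ} {Ω : Set (EuclideanSpace ℝ (Fin N))}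
    (hΩo : IsOpen Ω) (hΩb : Bornology.IsBounded Ω) {p q lam : ℝ} (hp : 1 < p) (hq : 1 < q)
    {a u : EuclideanSpace ℝ (Fin N) → ℝ} (ha : ContinuousOn a (closure Ω))
    (hu : DirichletSol Ω p q lam a u) :
    ∫ x in Ω, ‖gradient u x‖ ^ p
      = ∫ x in Ω, (lam * u x ^ (p - 1) + a x * u x ^ (q - 1)) * u x := by
  obtain ⟨huc, hud, hgc, hu0, hub, hint, hweak⟩ := hu
  have hcpt : IsCompact (closure Ω) := hΩb.isCompact_closure
  have hu1 : ContDiffOn ℝ 1 u Ω := by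
    have h := (contDiffOn_succ_iff_fderiv_of_isOpen (𝕜 := ℝ) (n := 0) (f := u) hΩo).2
      ⟨fun x hx => (hud x hx).differentiableWithinAt, by simp, ?_⟩
    · simpa using h
    · rw [contDiffOn_zero]
      refine ((InnerProductSpace.toDual ℝ (EuclideanSpace ℝ (Fin N))).continuous.comp_continuousOn
        hgc).congr fun x _ => ?_
      simp [gradient]
  set h : EuclideanSpace ℝ (Fin N) → ℝ := fun x => lam * u x ^ (p - 1) + a x * u x ^ (q - 1)
  have hhc : ContinuousOn h (closure Ω) :=
    (continuousOn_const.mul (huc.rpow_const fun _ _ => Or.inr (by linarith))).add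
      (ha.mul (huc.rpow_const fun _ _ => Or.inr (by linarith)))
  set F : EuclideanSpace ℝ (Fin N) → EuclideanSpace ℝ (Fin N) := fun x =>
    ‖gradient u x‖ ^ (p - 2) • gradient u x
  have hF : ∀ K ⊆ Ω, IsCompact K → IntegrableOn F K := by
    intro K hKΩ hK
    have hgK := hgc.mono hKΩ
    have hgm : AEStronglyMeasurable (fun x => gradient u x) (volume.restrict K) :=
      hgK.aestronglyMeasurable hK.measurableSet
    have hb : IntegrableOn (fun x => ‖gradient u x‖ ^ (p - 1)) K :=
      (hgK.norm.rpow_const fun _ _ => Or.inr (by linarith)).integrableOn_compact hK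
    refine hb.mono' ?_ (ae_of_all _ fun x => ?_)
    · exact (hgm.norm.aemeasurable.pow_const (p - 2)).aestronglyMeasurable.smul hgm
    · rw [norm_smul, Real.norm_eq_abs, abs_of_nonneg (by positivity)]
      rcases (norm_nonneg (gradient u x)).eq_or_lt with h0 | h0
      · rw [← h0, mul_zero]; positivity
      · rw [← Real.rpow_add_one h0.ne']
        exact (congrArg _ (by ring)).le
  have hweak' : ∀ φ, IsTestFun Ω φ → ∫ x in Ω, fderiv ℝ φ x (F x) = ∫ x in Ω, h x * φ x := by
    intro φ hφ
    rw [← hweak φ hφ]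
    refine integral_congr_ae (ae_of_all _ fun x => ?_)
    simp [F]
  obtain ⟨G, g, δ, hδ, hGd, hgcont, hg0, hg1, hGδ, hGt, hglim, hGlim⟩ :=
    exists_contDiff_truncations
  have htest : ∀ n, ∫ x in Ω, g n (u x) * ‖gradient u x‖ ^ p = ∫ x in Ω, h x * G n (u x) := by
    intro n
    have hG1 : ContDiff ℝ 1 (G n) := contDiff_one_iff_deriv.2
      ⟨fun t => (hGd n t).differentiableAt, by
        rw [show deriv (G n) = g n from funext fun t => (hGd n t).deriv]; exact hgcont n⟩
    obtain ⟨hw1, hwc, hwΩ⟩ := contDiff_one_indicator_comp hΩo hΩb huc hu1 hub hG1 (hδ n) (hGδ n)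
    have := weak_identity_of_contDiff_one hΩo hF
      (fun K hKΩ hK => (hhc.mono (hKΩ.trans subset_closure)).integrableOn_compact hK)
      hweak' hw1 hwc hwΩ
    have hright : ∫ x in Ω, h x * Ω.indicator (G n ∘ u) x = ∫ x in Ω, h x * G n (u x) :=
      setIntegral_congr_fun hΩo.measurableSet fun x hx => by simp [indicator_of_mem hx]
    rw [← hright, ← this]
    refine setIntegral_congr_fun hΩo.measurableSet fun x hx => Eq.symm ?_
    have hev : Ω.indicator (G n ∘ u) =ᶠ[𝓝 x] G n ∘ u := by
      filter_upwards [hΩo.mem_nhds hx] with y hy using indicator_of_mem hy _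
    have hfd : HasFDerivAt (G n ∘ u) (g n (u x) • fderiv ℝ u x) x :=
      (hGd n (u x)).comp_hasFDerivAt x (hud x hx).hasFDerivAt
    simp only [hev.fderiv_eq, hfd.fderiv, F, _root_.map_smul, _root_.smul_apply,
      ← inner_gradient_eq_fderiv, real_inner_self_eq_norm_sq, smul_eq_mul]
    rcases (norm_nonneg (gradient u x)).eq_or_lt with h0 | h0
    · rw [← h0, Real.zero_rpow (by linarith : p ≠ 0)]; simp
    · have : ‖gradient u x‖ ^ p = ‖gradient u x‖ ^ (p - 2) * ‖gradient u x‖ ^ 2 := by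
        rw [← Real.rpow_natCast, ← Real.rpow_add h0]; norm_num
      rw [this]; ring
  have hgrad0 : ∀ x ∈ Ω, u x = 0 → gradient u x = 0 := by
    intro x hx hx0
    have hmin : IsLocalMin u x := by
      filter_upwards [hΩo.mem_nhds hx] with y hy
      rw [hx0]; exact hu0 y hy
    rw [gradient, hmin.fderiv_eq_zero, map_zero]
  have huΩ : ContinuousOn u Ω := huc.mono subset_closure
  have h1 : Tendsto (fun n => ∫ x in Ω, g n (u x) * ‖gradient u x‖ ^ p) atTop
      (𝓝 (∫ x in Ω, ‖gradient u x‖ ^ p)) := by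
    refine tendsto_integral_of_dominated_convergence (fun x => ‖gradient u x‖ ^ p) (fun n => ?_)
      hint (fun n => ae_of_all _ fun x => ?_) ?_
    · exact (((hgcont n).comp_continuousOn huΩ).aestronglyMeasurable hΩo.measurableSet).mul
        hint.aestronglyMeasurable
    · rw [Real.norm_eq_abs, abs_of_nonneg (mul_nonneg (hg0 n _) (by positivity))]
      exact mul_le_of_le_one_left (by positivity) (hg1 n _)
    · refine (ae_restrict_iff' hΩo.measurableSet).2 (ae_of_all _ fun x hx => ?_)
      rcases (hu0 x hx).eq_or_lt with h0 | h0
      · simp [hgrad0 x hx h0.symm, Real.zero_rpow (by linarith : p ≠ 0)]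
      · simpa using (hglim _ h0).mul_const (‖gradient u x‖ ^ p)
  have h2 : Tendsto (fun n => ∫ x in Ω, h x * G n (u x)) atTop (𝓝 (∫ x in Ω, h x * u x)) := by
    have hb : IntegrableOn (fun x => ‖h x‖ * u x) Ω :=
      ((hhc.norm.mul huc).integrableOn_compact hcpt).mono_set subset_closure
    refine tendsto_integral_of_dominated_convergence _ (fun n => ?_) hb (fun n => ?_) ?_
    · have hGc : Continuous (G n) :=
        continuous_iff_continuousAt.2 fun t => (hGd n t).continuousAt
      exact ((hhc.mono subset_closure).mul (hGc.comp_continuousOn huΩ)).aestronglyMeasurable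
        hΩo.measurableSet
    · refine (ae_restrict_iff' hΩo.measurableSet).2 (ae_of_all _ fun x hx => ?_)
      rw [norm_mul]
      gcongr
      exact hGt n _ (hu0 x hx)
    · refine (ae_restrict_iff' hΩo.measurableSet).2 (ae_of_all _ fun x hx => ?_)
      exact (hGlim _ (hu0 x hx)).const_mul _
  exact tendsto_nhds_unique h1 (h2.congr fun n => (htest n).symm)

/-- A lower power is dominated by a small constant plus a large multiple of a higher power. -/
theorem exists_mul_rpow_le_add_mul_rpow {A η p q : ℝ} (hA : 0 < A) (hη : 0 < η) (hq : 0 < q)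
    (hqp : q ≤ p) : ∃ M : ℝ, 0 ≤ M ∧ ∀ t : ℝ, 0 ≤ t → A * t ^ q ≤ η + M * t ^ p := by
  set s : ℝ := (η / A) ^ q⁻¹
  have hs : 0 < s := by positivity
  have hsq : A * s ^ q = η := by
    rw [Real.rpow_inv_rpow (by positivity) hq.ne', mul_div_cancel₀ _ hA.ne']
  refine ⟨A * s ^ (q - p), by positivity, fun t ht => ?_⟩
  rcases le_or_gt t s with hts | hts
  · calc A * t ^ q ≤ A * s ^ q := by gcongr
      _ ≤ η + A * s ^ (q - p) * t ^ p := by rw [hsq]; exact le_add_of_nonneg_right (by positivity)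
  · have ht0 : 0 < t := hs.trans hts
    calc A * t ^ q = A * t ^ (q - p) * t ^ p := by
          rw [mul_assoc, ← Real.rpow_add ht0, sub_add_cancel]
      _ ≤ A * s ^ (q - p) * t ^ p := by
          gcongr ?_ * _
          exact mul_le_mul_of_nonneg_left
            (Real.rpow_le_rpow_of_nonpos hs hts.le (by linarith)) hA.le
      _ ≤ _ := le_add_of_nonneg_left hη.le

/-- Solutions positive on `Ω_a^+` tend to `0` in `W^{1,p}` as `λ → -∞`. -/
theorem solutions_tend_to_zero_as_lambda_to_neg_infty
    {N : ℕ} (hN : 1 ≤ N) (Ω : Set (EuclideanSpace ℝ (Fin N)))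
    (hΩne : Ω.Nonempty) (hΩo : IsOpen Ω) (hΩb : Bornology.IsBounded Ω)
    (p q : ℝ) (h1q : 1 < q) (hqp : q < p)
    (a : EuclideanSpace ℝ (Fin N) → ℝ) (ha : ContinuousOn a (closure Ω))
    (haplus : ∃ x ∈ Ω, 0 < a x) (haminus : ∃ x ∈ Ω, a x < 0) :
    ∀ ε : ℝ, 0 < ε → ∃ Λ : ℝ, Λ < 0 ∧ ∀ lam : ℝ, lam ≤ Λ →
      ∀ u : EuclideanSpace ℝ (Fin N) → ℝ,
        DirichletSol Ω p q lam a u → (∀ x ∈ Ω, 0 < a x → 0 < u x) →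
        (∫ x in Ω, (‖gradient u x‖ ^ p + u x ^ p)) < ε := by
  intro ε hε
  have hcpt : IsCompact (closure Ω) := hΩb.isCompact_closure
  have hp : 1 < p := h1q.trans hqp
  obtain ⟨A, hA⟩ := hcpt.exists_bound_of_continuousOn ha
  have hV : volume Ω ≠ ⊤ := hΩb.measure_lt_top.ne
  set V : ℝ := volume.real Ω
  have hV0 : 0 ≤ V := measureReal_nonneg
  obtain ⟨M, hM0, hM⟩ := exists_mul_rpow_le_add_mul_rpow (A := |A| + 1) (η := ε / (V + 1)) (p := p)
    (q := q) (by positivity) (by positivity) (by linarith) hqp.le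
  refine ⟨-(M + 1), by linarith, fun lam hlam u hu _ => ?_⟩
  have henergy := hu.energy_identity hΩo hΩb hp h1q ha
  obtain ⟨huc, -, -, hu0, -, hint, -⟩ := hu
  have hup : IntegrableOn (fun x => u x ^ p) Ω :=
    ((huc.rpow_const fun _ _ => Or.inr (by linarith)).integrableOn_compact hcpt).mono_set
      subset_closure
  have hh : IntegrableOn (fun x => (lam * u x ^ (p - 1) + a x * u x ^ (q - 1)) * u x) Ω := by
    refine ((ContinuousOn.mul ?_ huc).integrableOn_compact hcpt).mono_set
      subset_closure
    exact (continuousOn_const.mul (huc.rpow_const fun _ _ => Or.inr (by linarith))).add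
      (ha.mul (huc.rpow_const fun _ _ => Or.inr (by linarith)))
  rw [integral_add hint hup, henergy, ← integral_add hh hup]
  calc ∫ x in Ω, ((lam * u x ^ (p - 1) + a x * u x ^ (q - 1)) * u x + u x ^ p)
      ≤ ∫ _ in Ω, ε / (V + 1) := by
        refine setIntegral_mono_on (hh.add hup) (integrableOn_const hV) hΩo.measurableSet
          fun x hx => ?_
        have hux := hu0 x hx
        have e : ∀ r : ℝ, 1 < r → u x ^ (r - 1) * u x = u x ^ r := fun r hr => by
          rw [← Real.rpow_add_one' hux (by linarith), sub_add_cancel]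
        have h1 : (lam * u x ^ (p - 1) + a x * u x ^ (q - 1)) * u x + u x ^ p
            = (lam + 1) * u x ^ p + a x * u x ^ q := by
          rw [← e p hp, ← e q h1q]; ring
        have h2 : a x * u x ^ q ≤ (|A| + 1) * u x ^ q := by
          gcongr
          have := (le_abs_self _).trans (hA x (subset_closure hx))
          linarith [le_abs_self A]
        have h3 : (lam + 1) * u x ^ p ≤ -M * u x ^ p := by
          gcongr
          linarith
        rw [h1]
        linarith [hM _ hux]
    _ = V * (ε / (V + 1)) := by simp [V]
    _ < ε := by
        rw [← mul_div_assoc, div_lt_iff₀ (by positivity)]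
        nlinarith
end
end

section
/- λ*(a,q) converges to λ*(a,p) as q → p from the left; that is, for every ε > 0 there exists δ > 0 such that for every real q with p − δ < q < p one has |λ*(a,q) − λ*(a,p)| < ε. -/
open MeasureTheory RealInnerProductSpace

noncomputable section

theorem abs_rpow_sub_rpow_le {t p q s : ℝ} (ht : 0 ≤ t) (hq : 1 ≤ q) (hqp : q < p) (hs : 1 < s) :
    |t ^ p - t ^ q| ≤ (p - q) * (1 + (t ^ p) ^ s / (p * (s - 1))) := by
  have hp : 0 < p := by linarith
  have hε : 0 < p * (s - 1) := mul_pos hp (by linarith)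
  have hd : 0 < p - q := by linarith
  rcases ht.eq_or_lt with rfl | ht
  · rw [Real.zero_rpow hp.ne', Real.zero_rpow (by linarith), Real.zero_rpow (by linarith)]
    simp [hqp.le]
  rcases le_total t 1 with h1 | h1
  · have hle : t ^ p ≤ t ^ q := Real.rpow_le_rpow_of_exponent_ge ht h1 hqp.le
    rw [abs_of_nonpos (by linarith)]
    have hfac : t ^ p = t ^ q * t ^ (p - q) := by rw [← Real.rpow_add ht]; ring_nf
    have hexp : 1 + Real.log t * (p - q) ≤ t ^ (p - q) := by
      rw [Real.rpow_def_of_pos ht]; linarith [Real.add_one_le_exp (Real.log t * (p - q))]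
    have hlog : Real.log t ≤ 0 := Real.log_nonpos ht.le h1
    have hqt : t ^ q ≤ t := by
      simpa using Real.rpow_le_rpow_of_exponent_ge ht h1 hq
    have hinv : t * (-Real.log t) ≤ 1 := by
      have h := Real.one_sub_inv_le_log_of_pos ht
      have h2 : t * (1 - t⁻¹) ≤ t * Real.log t := by gcongr
      rw [mul_sub, mul_inv_cancel₀ ht.ne'] at h2
      linarith
    have hqpos : 0 < t ^ q := by positivity
    calc -(t ^ p - t ^ q) = t ^ q * (1 - t ^ (p - q)) := by rw [hfac]; ring
      _ ≤ t ^ q * (-(Real.log t * (p - q))) := by gcongr; linarith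
      _ = (p - q) * (t ^ q * -Real.log t) := by ring
      _ ≤ (p - q) * (t * -Real.log t) := by gcongr; linarith
      _ ≤ (p - q) * (1 + (t ^ p) ^ s / (p * (s - 1))) := by
        gcongr
        have : 0 ≤ (t ^ p) ^ s / (p * (s - 1)) := by positivity
        linarith
  · have hle : t ^ q ≤ t ^ p := Real.rpow_le_rpow_of_exponent_le h1 hqp.le
    rw [abs_of_nonneg (by linarith)]
    have hfac : t ^ q = t ^ p * t ^ (q - p) := by rw [← Real.rpow_add ht]; ring_nf
    have hexp : 1 + Real.log t * (q - p) ≤ t ^ (q - p) := by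
      rw [Real.rpow_def_of_pos ht]; linarith [Real.add_one_le_exp (Real.log t * (q - p))]
    have hlog := Real.log_le_rpow_div ht.le hε
    have hpow : (t ^ p) ^ s = t ^ p * t ^ (p * (s - 1)) := by
      rw [← Real.rpow_mul ht.le, ← Real.rpow_add ht]; ring_nf
    calc t ^ p - t ^ q = t ^ p * (1 - t ^ (q - p)) := by rw [hfac]; ring
      _ ≤ t ^ p * (-(Real.log t * (q - p))) := by gcongr; linarith
      _ = (p - q) * (t ^ p * Real.log t) := by ring
      _ ≤ (p - q) * (t ^ p * (t ^ (p * (s - 1)) / (p * (s - 1)))) := by gcongr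
      _ ≤ (p - q) * (1 + (t ^ p) ^ s / (p * (s - 1))) := by
        gcongr
        rw [hpow, mul_div_assoc]; linarith

theorem enorm_le_lintegral_fderiv_of_finrank_eq_one {E : Type*} [NormedAddCommGroup E]
    [InnerProductSpace ℝ E] [FiniteDimensional ℝ E] [MeasurableSpace E] [BorelSpace E]
    (hE : Module.finrank ℝ E = 1) {w : E → ℝ} (hw : ContDiff ℝ 1 w) (hcs : HasCompactSupport w)
    (x : E) : ‖w x‖ₑ ≤ ∫⁻ y, ‖fderiv ℝ w y‖ₑ := by
  let L : ℝ ≃ₗᵢ[ℝ] E := (stdOrthonormalBasis ℝ ℝ).equiv (stdOrthonormalBasis ℝ E)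
    (finCongr (by simp [hE]))
  obtain ⟨t, rfl⟩ := L.surjective x
  have hd : ∀ y, ‖deriv (w ∘ L) y‖ₑ ≤ ‖fderiv ℝ w (L y)‖ₑ := fun y => by
    have h : HasDerivAt (w ∘ L) (fderiv ℝ w (L y) (L 1)) y := by
      have h1 : HasDerivAt L (L 1) y := by
        simpa using (L.toContinuousLinearEquiv.toContinuousLinearMap.hasFDerivAt (x := y)).hasDerivAt
      exact ((hw.differentiable one_ne_zero (L y)).hasFDerivAt).comp_hasDerivAt y h1
    rw [h.deriv, enorm_le_iff_norm_le]
    simpa using (fderiv ℝ w (L y)).le_opNorm (L 1)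
  calc ‖w (L t)‖ₑ ≤ ∫⁻ y in Set.Iic t, ‖deriv (w ∘ L) y‖ₑ :=
        HasCompactSupport.enorm_le_lintegral_Ici_deriv (hw.comp L.contDiff)
          (hcs.comp_homeomorph L.toHomeomorph) t
    _ ≤ ∫⁻ y, ‖deriv (w ∘ L) y‖ₑ := setLIntegral_le_lintegral _ _
    _ ≤ ∫⁻ y, ‖fderiv ℝ w (L y)‖ₑ := lintegral_mono hd
    _ = ∫⁻ y, ‖fderiv ℝ w y‖ₑ :=
        L.measurePreserving.lintegral_comp_emb L.toHomeomorph.measurableEmbedding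
          (fun y => ‖fderiv ℝ w y‖ₑ)

theorem exists_setLIntegral_rpow_le_lintegral_fderiv {E : Type*} [NormedAddCommGroup E]
    [InnerProductSpace ℝ E] [FiniteDimensional ℝ E] [MeasurableSpace E] [BorelSpace E]
    [Nontrivial E] {Ω : Set E} (hΩ : Bornology.IsBounded Ω) :
    ∃ s : ℝ, 1 < s ∧ ∃ C : ENNReal, C ≠ ⊤ ∧ ∀ w : E → ℝ, ContDiff ℝ 1 w → HasCompactSupport w →
      ∫⁻ x in Ω, ‖w x‖ₑ ^ s ≤ C * (∫⁻ x, ‖fderiv ℝ w x‖ₑ) ^ s := by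
  have hpos : 0 < Module.finrank ℝ E := Module.finrank_pos
  rcases (Nat.succ_le_of_lt hpos).eq_or_lt with h1 | h1
  · refine ⟨2, one_lt_two, volume Ω, hΩ.measure_lt_top.ne, fun w hw hcs => ?_⟩
    calc ∫⁻ x in Ω, ‖w x‖ₑ ^ (2 : ℝ) ≤ ∫⁻ x in Ω, (∫⁻ y, ‖fderiv ℝ w y‖ₑ) ^ (2 : ℝ) := by
          refine lintegral_mono fun x => ?_
          gcongr
          exact enorm_le_lintegral_fderiv_of_finrank_eq_one h1.symm hw hcs x
      _ = _ := by rw [setLIntegral_const, mul_comm]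
  · have h1' : (1 : ℝ) < Module.finrank ℝ E := by exact_mod_cast h1
    have hc := Real.HolderConjugate.conjExponent h1'
    exact ⟨_, hc.symm.lt, lintegralPowLePowLIntegralFDerivConst volume _, ENNReal.coe_ne_top,
      fun w hw hcs => (setLIntegral_le_lintegral _ _).trans
        (lintegral_pow_le_pow_lintegral_fderiv volume hw hcs hc)⟩

theorem norm_gradient {E : Type*} [NormedAddCommGroup E] [InnerProductSpace ℝ E] [CompleteSpace E]
    (f : E → ℝ) (x : E) : ‖gradient f x‖ = ‖fderiv ℝ f x‖ := by
  simp [gradient]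

theorem ContinuousOn.integrableOn_of_isBounded {E : Type*} [NormedAddCommGroup E]
    [InnerProductSpace ℝ E] [FiniteDimensional ℝ E] [MeasurableSpace E] [BorelSpace E]
    {Ω : Set E} (hΩ : Bornology.IsBounded Ω) {f : E → ℝ} (hf : ContinuousOn f (closure Ω)) :
    IntegrableOn f Ω :=
  (hf.integrableOn_compact hΩ.isCompact_closure).mono_set subset_closure

namespace IsTestFun

variable {N : ℕ} {Ω : Set (EuclideanSpace ℝ (Fin N))} {φ : EuclideanSpace ℝ (Fin N) → ℝ}

theorem continuous (hφ : IsTestFun Ω φ) : Continuous φ := hφ.1.continuous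

theorem contDiff_one (hφ : IsTestFun Ω φ) : ContDiff ℝ 1 φ := hφ.1.of_le (by exact_mod_cast le_top)

theorem differentiable (hφ : IsTestFun Ω φ) : Differentiable ℝ φ :=
  hφ.contDiff_one.differentiable one_ne_zero

theorem continuous_abs_rpow (hφ : IsTestFun Ω φ) {r : ℝ} (hr : 0 ≤ r) :
    Continuous fun x => |φ x| ^ r :=
  hφ.continuous.abs.rpow_const fun _ => Or.inr hr

theorem continuous_norm_gradient_rpow (hφ : IsTestFun Ω φ) {r : ℝ} (hr : 0 ≤ r) :
    Continuous fun x => ‖gradient φ x‖ ^ r := by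
  simp_rw [norm_gradient]
  exact (hφ.contDiff_one.continuous_fderiv one_ne_zero).norm.rpow_const fun _ => Or.inr hr

theorem integrableOn_abs_rpow (hφ : IsTestFun Ω φ) (hΩ : Bornology.IsBounded Ω) {r : ℝ}
    (hr : 0 ≤ r) : IntegrableOn (fun x => |φ x| ^ r) Ω :=
  (hφ.continuous_abs_rpow hr).continuousOn.integrableOn_of_isBounded hΩ

theorem integrableOn_mul_abs_rpow (hφ : IsTestFun Ω φ) (hΩ : Bornology.IsBounded Ω)
    {a : EuclideanSpace ℝ (Fin N) → ℝ} (ha : ContinuousOn a (closure Ω)) {r : ℝ}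
    (hr : 0 ≤ r) : IntegrableOn (fun x => a x * |φ x| ^ r) Ω :=
  (ha.mul (hφ.continuous_abs_rpow hr).continuousOn).integrableOn_of_isBounded hΩ

theorem integrableOn_norm_gradient_rpow (hφ : IsTestFun Ω φ) (hΩ : Bornology.IsBounded Ω) {r : ℝ}
    (hr : 0 ≤ r) : IntegrableOn (fun x => ‖gradient φ x‖ ^ r) Ω :=
  (hφ.continuous_norm_gradient_rpow hr).continuousOn.integrableOn_of_isBounded hΩ

theorem lintegral_fderiv_abs_rpow_le (hφ : IsTestFun Ω φ) (hΩ : Bornology.IsBounded Ω) {p : ℝ}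
    (hp : 1 < p) :
    ∫⁻ x, ‖fderiv ℝ (fun y => |φ y| ^ p) x‖ₑ ≤
      ENNReal.ofReal (p * ((∫ x in Ω, |φ x| ^ p) + ∫ x in Ω, ‖gradient φ x‖ ^ p)) := by
  have hp0 : 0 < p := by linarith
  have hsupp : (fun x => ‖fderiv ℝ (fun y => |φ y| ^ p) x‖ₑ).support ⊆ Ω := by
    refine subset_trans ?_ ((tsupport_comp_subset (g := fun t : ℝ => |t| ^ p)
      (by simp [hp0.ne']) φ).trans hφ.2.2)
    intro x hx
    exact support_fderiv_subset ℝ (f := fun y => |φ y| ^ p) (fun h => hx (by simp [← ofReal_norm, h]))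
  rw [← setLIntegral_eq_of_support_subset hsupp,
    ← integral_add (hφ.integrableOn_abs_rpow hΩ hp0.le)
      (hφ.integrableOn_norm_gradient_rpow hΩ hp0.le), ← integral_const_mul,
    ofReal_integral_eq_lintegral_ofReal]
  · refine lintegral_mono fun x => ?_
    rw [← ofReal_norm]
    refine ENNReal.ofReal_le_ofReal ?_
    have h := norm_fderiv_norm_rpow_le hφ.differentiable (x := x) hp
    simp only [Real.norm_eq_abs] at h
    refine h.trans ?_
    rw [mul_assoc, norm_gradient]
    gcongr
    set u := |φ x| with hu
    set v := ‖fderiv ℝ φ x‖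
    have hu0 : 0 ≤ u := abs_nonneg _
    have hv0 : 0 ≤ v := norm_nonneg _
    have hmul : ∀ z : ℝ, 0 ≤ z → z ^ (p - 1) * z = z ^ p := fun z hz => by
      rw [← Real.rpow_add_one' hz (by linarith)]; ring_nf
    have hup : 0 ≤ u ^ p := by positivity
    have hvp : 0 ≤ v ^ p := by positivity
    rcases le_total u v with huv | huv
    · have : u ^ (p - 1) * v ≤ v ^ (p - 1) * v := by gcongr
      rw [hmul v hv0] at this
      linarith
    · have : u ^ (p - 1) * v ≤ u ^ (p - 1) * u := by gcongr
      rw [hmul u hu0] at this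
      linarith
  · exact ((hφ.integrableOn_abs_rpow hΩ hp0.le).add
      (hφ.integrableOn_norm_gradient_rpow hΩ hp0.le)).const_mul p
  · exact Filter.Eventually.of_forall fun x => by positivity

end IsTestFun

theorem exists_integral_abs_rpow_rpow_le {N : ℕ} (hN : 1 ≤ N)
    {Ω : Set (EuclideanSpace ℝ (Fin N))} (hΩ : Bornology.IsBounded Ω) {p : ℝ} (hp : 1 < p) (M : ℝ) :
    ∃ s : ℝ, 1 < s ∧ ∃ C : ℝ, ∀ φ : EuclideanSpace ℝ (Fin N) → ℝ, IsTestFun Ω φ →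
      (∫ x in Ω, |φ x| ^ p) = 1 → (∫ x in Ω, ‖gradient φ x‖ ^ p) ≤ M →
      ∫ x in Ω, (|φ x| ^ p) ^ s ≤ C := by
  have : Nonempty (Fin N) := ⟨⟨0, hN⟩⟩
  have : Nontrivial (EuclideanSpace ℝ (Fin N)) :=
    Module.nontrivial_of_finrank_pos (R := ℝ) (by simp; omega)
  obtain ⟨s, hs, C, hC, h⟩ := exists_setLIntegral_rpow_le_lintegral_fderiv hΩ
  refine ⟨s, hs, (C * ENNReal.ofReal (p * (1 + M)) ^ s).toReal, fun φ hφ hnorm hM => ?_⟩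
  have hp0 : 0 < p := by linarith
  have hw : ContDiff ℝ 1 fun x => |φ x| ^ p := (contDiff_norm_rpow hp).comp hφ.contDiff_one
  have hcs : HasCompactSupport fun x => |φ x| ^ p :=
    hφ.2.1.comp_left (g := fun t : ℝ => |t| ^ p) (by simp [hp0.ne'])
  rw [integral_eq_lintegral_of_nonneg_ae (Filter.Eventually.of_forall fun x => by positivity)
    (hw.continuous.rpow_const fun _ => Or.inr (by linarith)).aestronglyMeasurable]
  refine ENNReal.toReal_mono (ENNReal.mul_ne_top hC (ENNReal.rpow_ne_top_of_nonneg (by linarith)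
    ENNReal.ofReal_ne_top)) ?_
  calc ∫⁻ x in Ω, ENNReal.ofReal ((|φ x| ^ p) ^ s) = ∫⁻ x in Ω, ‖|φ x| ^ p‖ₑ ^ s := by
        refine lintegral_congr fun x => ?_
        rw [Real.enorm_of_nonneg (by positivity),
          ENNReal.ofReal_rpow_of_nonneg (by positivity) (by linarith)]
    _ ≤ C * (∫⁻ x, ‖fderiv ℝ (fun y => |φ y| ^ p) x‖ₑ) ^ s := h _ hw hcs
    _ ≤ C * ENNReal.ofReal (p * (1 + M)) ^ s := by
        gcongr
        refine (hφ.lintegral_fderiv_abs_rpow_le hΩ hp).trans ?_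
        rw [hnorm]
        gcongr

theorem exists_abs_integral_sub_integral_le {N : ℕ} (hN : 1 ≤ N)
    {Ω : Set (EuclideanSpace ℝ (Fin N))} (hΩo : IsOpen Ω) (hΩ : Bornology.IsBounded Ω)
    {a : EuclideanSpace ℝ (Fin N) → ℝ} (ha : ContinuousOn a (closure Ω))
    {p : ℝ} (hp : 1 < p) (M : ℝ) :
    ∃ K : ℝ, ∀ q : ℝ, 1 ≤ q → q < p → ∀ φ : EuclideanSpace ℝ (Fin N) → ℝ, IsTestFun Ω φ →
      (∫ x in Ω, |φ x| ^ p) = 1 → (∫ x in Ω, ‖gradient φ x‖ ^ p) ≤ M →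
      |(∫ x in Ω, a x * |φ x| ^ p) - ∫ x in Ω, a x * |φ x| ^ q| ≤ (p - q) * K := by
  obtain ⟨s, hs, C, hC⟩ := exists_integral_abs_rpow_rpow_le hN hΩ hp M
  obtain ⟨A, hA⟩ := hΩ.isCompact_closure.exists_bound_of_continuousOn ha
  refine ⟨|A| * (volume.real Ω + C / (p * (s - 1))), fun q hq hqp φ hφ hnorm hM => ?_⟩
  have hp0 : 0 < p := by linarith
  have hps : 0 < p * (s - 1) := mul_pos hp0 (by linarith)
  have hd : 0 < p - q := by linarith
  have hint : IntegrableOn (fun x => (|φ x| ^ p) ^ s) Ω :=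
    ((hφ.continuous_abs_rpow hp0.le).rpow_const fun _ =>
      Or.inr (by linarith)).continuousOn.integrableOn_of_isBounded hΩ
  have hvol : IntegrableOn (fun _ => (1 : ℝ)) Ω := integrableOn_const hΩ.measure_lt_top.ne
  rw [← integral_sub (hφ.integrableOn_mul_abs_rpow hΩ ha hp0.le)
    (hφ.integrableOn_mul_abs_rpow hΩ ha (by linarith))]
  calc |∫ x in Ω, (a x * |φ x| ^ p - a x * |φ x| ^ q)|
      ≤ ∫ x in Ω, |A| * ((p - q) * (1 + (|φ x| ^ p) ^ s / (p * (s - 1)))) := by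
        rw [← Real.norm_eq_abs]
        refine norm_integral_le_of_norm_le (((hvol.add (hint.div_const _)).const_mul _).const_mul _)
          ((ae_restrict_mem hΩo.measurableSet).mono fun x hx => ?_)
        rw [← mul_sub, norm_mul]
        gcongr
        · exact (hA x (subset_closure hx)).trans (le_abs_self A)
        · exact abs_rpow_sub_rpow_le (abs_nonneg _) hq hqp hs
    _ = |A| * ((p - q) * (volume.real Ω + (∫ x in Ω, (|φ x| ^ p) ^ s) / (p * (s - 1)))) := by
        rw [integral_const_mul, integral_const_mul, integral_add hvol (hint.div_const _),
          integral_div]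
        simp
    _ ≤ |A| * ((p - q) * (volume.real Ω + C / (p * (s - 1)))) := by
        gcongr
        exact hC φ hφ hnorm hM
    _ = _ := by ring

namespace IsTestFun

variable {N : ℕ} {Ω : Set (EuclideanSpace ℝ (Fin N))} {φ ψ : EuclideanSpace ℝ (Fin N) → ℝ}

theorem const_mul (hφ : IsTestFun Ω φ) (c : ℝ) : IsTestFun Ω fun x => c * φ x :=
  ⟨contDiff_const.mul hφ.1, hφ.2.1.comp_left (g := fun t : ℝ => c * t) (mul_zero c),
    (tsupport_comp_subset (g := fun t : ℝ => c * t) (mul_zero c) φ).trans hφ.2.2⟩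

theorem norm_gradient_const_mul (hφ : IsTestFun Ω φ) (c : ℝ) (x : EuclideanSpace ℝ (Fin N)) :
    ‖gradient (fun x => c * φ x) x‖ = |c| * ‖gradient φ x‖ := by
  rw [norm_gradient, norm_gradient, fderiv_const_mul (hφ.differentiable x), norm_smul,
    Real.norm_eq_abs]

theorem add (hφ : IsTestFun Ω φ) (hψ : IsTestFun Ω ψ) : IsTestFun Ω fun x => φ x + ψ x :=
  ⟨hφ.1.add hψ.1, hφ.2.1.add hψ.2.1,
    (tsupport_add φ ψ).trans (Set.union_subset hφ.2.2 hψ.2.2)⟩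

theorem sqrt_sq_add_sq_sub (hφ : IsTestFun Ω φ) {δ : ℝ} (hδ : 0 < δ) :
    IsTestFun Ω fun x => √(φ x ^ 2 + δ ^ 2) - δ := by
  have h0 : (fun t : ℝ => √(t ^ 2 + δ ^ 2) - δ) 0 = 0 := by simp [Real.sqrt_sq hδ.le]
  exact ⟨(((hφ.1.pow 2).add contDiff_const).sqrt fun x => by positivity).sub contDiff_const,
    hφ.2.1.comp_left (g := fun t : ℝ => √(t ^ 2 + δ ^ 2) - δ) h0,
    (tsupport_comp_subset (g := fun t : ℝ => √(t ^ 2 + δ ^ 2) - δ) h0 φ).trans hφ.2.2⟩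

theorem norm_gradient_sqrt_sq_add_sq_sub_le (hφ : IsTestFun Ω φ) {δ : ℝ} (hδ : 0 < δ)
    (x : EuclideanSpace ℝ (Fin N)) :
    ‖gradient (fun x => √(φ x ^ 2 + δ ^ 2) - δ) x‖ ≤ ‖gradient φ x‖ := by
  have hpos : 0 < √(φ x ^ 2 + δ ^ 2) := by positivity
  have h := ((((hφ.differentiable x).hasFDerivAt.pow 2).add_const (δ ^ 2)).sqrt
    (by positivity)).sub_const δ
  rw [norm_gradient, norm_gradient, h.fderiv, smul_smul, norm_smul]
  refine mul_le_of_le_one_left (norm_nonneg _) ?_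
  rw [Real.norm_eq_abs, abs_le_one_iff_mul_self_le_one]
  simp only [nsmul_eq_mul, Nat.cast_ofNat, Nat.add_one_sub_one, pow_one]
  field_simp
  rw [Real.sq_sqrt (by positivity)]
  nlinarith [sq_nonneg δ]

theorem integral_abs_const_mul_rpow (φ : EuclideanSpace ℝ (Fin N) → ℝ) {c : ℝ} (hc : 0 ≤ c)
    (a : EuclideanSpace ℝ (Fin N) → ℝ) (r : ℝ) :
    ∫ x in Ω, a x * |c * φ x| ^ r = c ^ r * ∫ x in Ω, a x * |φ x| ^ r := by
  rw [← integral_const_mul]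
  refine integral_congr_ae (Filter.Eventually.of_forall fun x => ?_)
  simp only [abs_mul, abs_of_nonneg hc, Real.mul_rpow hc (abs_nonneg _)]
  ring

theorem exists_normalized (hφ : IsTestFun Ω φ) {p r : ℝ} (hp : 0 < p)
    {a : EuclideanSpace ℝ (Fin N) → ℝ} (hpos : 0 < ∫ x in Ω, |φ x| ^ p)
    (hc : 0 ≤ ∫ x in Ω, a x * |φ x| ^ r) :
    (∫ x in Ω, ‖gradient φ x‖ ^ p) / (∫ x in Ω, |φ x| ^ p) ∈
      { E : ℝ | ∃ χ : EuclideanSpace ℝ (Fin N) → ℝ, IsTestFun Ω χ ∧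
        (∫ x in Ω, |χ x| ^ p) = 1 ∧ (0 ≤ ∫ x in Ω, a x * |χ x| ^ r) ∧
        E = ∫ x in Ω, ‖gradient χ x‖ ^ p } := by
  set I := ∫ x in Ω, |φ x| ^ p with hI
  have hc0 : 0 ≤ I ^ (-p⁻¹) := by positivity
  have hcp : (I ^ (-p⁻¹)) ^ p = I⁻¹ := by
    rw [← Real.rpow_mul hpos.le, neg_mul, inv_mul_cancel₀ hp.ne', Real.rpow_neg_one]
  refine ⟨_, hφ.const_mul (I ^ (-p⁻¹)), ?_, ?_, ?_⟩
  · have h := integral_abs_const_mul_rpow (Ω := Ω) φ hc0 (fun _ => 1) p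
    simp only [one_mul] at h
    rw [h, hcp, ← hI, inv_mul_cancel₀ hpos.ne']
  · rw [integral_abs_const_mul_rpow φ hc0]
    positivity
  · rw [div_eq_inv_mul, ← hcp, ← integral_const_mul]
    refine integral_congr_ae (Filter.Eventually.of_forall fun x => ?_)
    simp only
    rw [hφ.norm_gradient_const_mul, abs_of_nonneg hc0, Real.mul_rpow hc0 (norm_nonneg _)]

end IsTestFun

theorem lambdaStar_le {N : ℕ} {Ω : Set (EuclideanSpace ℝ (Fin N))}
    {φ : EuclideanSpace ℝ (Fin N) → ℝ} (hφ : IsTestFun Ω φ) {p r : ℝ} (hp : 0 < p)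
    {a : EuclideanSpace ℝ (Fin N) → ℝ} (h1 : 1 ≤ ∫ x in Ω, |φ x| ^ p)
    (hc : 0 ≤ ∫ x in Ω, a x * |φ x| ^ r) :
    lambdaStar Ω p r a ≤ ∫ x in Ω, ‖gradient φ x‖ ^ p := by
  refine (csInf_le ⟨0, ?_⟩ (hφ.exists_normalized hp (by linarith) hc)).trans
    (div_le_self (integral_nonneg fun x => by positivity) h1)
  rintro _ ⟨χ, -, -, -, rfl⟩
  exact integral_nonneg fun x => by positivity

theorem exists_isTestFun_support_subset_pos {N : ℕ} {Ω : Set (EuclideanSpace ℝ (Fin N))}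
    (hΩo : IsOpen Ω) (hΩ : Bornology.IsBounded Ω) {a : EuclideanSpace ℝ (Fin N) → ℝ}
    (ha : ContinuousOn a (closure Ω)) (hpos : ∃ x ∈ Ω, 0 < a x) {p : ℝ} (hp : 0 < p) :
    ∃ ψ : EuclideanSpace ℝ (Fin N) → ℝ, IsTestFun Ω ψ ∧ (∀ x, 0 ≤ ψ x) ∧
      (∀ x, ψ x ≠ 0 → 0 < a x) ∧ 0 < (∫ x in Ω, |ψ x| ^ p) ∧ 0 < ∫ x in Ω, a x * |ψ x| ^ p := by
  obtain ⟨x₀, hx₀, hax₀⟩ := hpos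
  have hnhds : Ω ∩ {x | 0 < a x} ∈ nhds x₀ := by
    have hcont : ContinuousAt a x₀ :=
      ha.continuousAt (Filter.mem_of_superset (hΩo.mem_nhds hx₀) subset_closure)
    exact Filter.inter_mem (hΩo.mem_nhds hx₀) (hcont.eventually (lt_mem_nhds hax₀))
  obtain ⟨ψ, hts, hcs, hsm, hran, hψx₀⟩ := exists_contDiff_tsupport_subset (n := ⊤) hnhds
  have hψ : IsTestFun Ω ψ := ⟨hsm, hcs, hts.trans Set.inter_subset_left⟩
  have hapos : ∀ x, ψ x ≠ 0 → 0 < a x := fun x hx =>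
    (hts (subset_tsupport ψ hx)).2
  have key : ∀ b : EuclideanSpace ℝ (Fin N) → ℝ, ContinuousOn b (closure Ω) →
      (∀ x, ψ x ≠ 0 → 0 < b x) → 0 < ∫ x in Ω, b x * |ψ x| ^ p := fun b hb hbpos => by
    rw [setIntegral_pos_iff_support_of_nonneg_ae _ (hψ.integrableOn_mul_abs_rpow hΩ hb hp.le)]
    · have hopen : IsOpen (Function.support ψ) := hψ.continuous.isOpen_support
      refine ((hopen.inter hΩo).measure_pos volume ⟨x₀, by simp [hψx₀], hx₀⟩).trans_le
        (measure_mono ?_)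
      rintro x ⟨hx, hxΩ⟩
      have := hbpos x hx
      have := abs_pos.mpr hx
      exact ⟨ne_of_gt (by positivity), hxΩ⟩
    · refine Filter.Eventually.of_forall fun x => ?_
      by_cases hx : ψ x = 0
      · simp [hx, hp.ne']
      · have := hbpos x hx
        simp only [Pi.zero_apply]
        positivity
  exact ⟨ψ, hψ, fun x => (hran ⟨x, rfl⟩).1, hapos,
    by simpa using key (fun _ => 1) continuousOn_const (by simp), key a ha hapos⟩

theorem rpow_add_mul_le {x y t p : ℝ} (hx : 0 ≤ x) (hy : 0 ≤ y) (ht : 0 ≤ t) (hp : 1 ≤ p) :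
    (x + t * y) ^ p ≤ (1 + t) ^ (p - 1) * (x ^ p + t * y ^ p) := by
  have h1 : 0 < 1 + t := by linarith
  have h := (convexOn_rpow hp).2 hx hy (show 0 ≤ 1 / (1 + t) by positivity)
    (show 0 ≤ t / (1 + t) by positivity) (by field_simp)
  simp only [smul_eq_mul] at h
  have e1 : 1 / (1 + t) * x + t / (1 + t) * y = (x + t * y) / (1 + t) := by field_simp
  have e2 : 1 / (1 + t) * x ^ p + t / (1 + t) * y ^ p = (x ^ p + t * y ^ p) / (1 + t) := by
    field_simp
  rw [e1, e2, Real.div_rpow (by positivity) h1.le, div_le_iff₀ (by positivity)] at h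
  rw [Real.rpow_sub_one h1.ne']
  calc _ ≤ _ := h
    _ = _ := by ring

theorem tendsto_integral_mul_abs_sqrt_rpow {N : ℕ} {Ω : Set (EuclideanSpace ℝ (Fin N))}
    {φ ψ : EuclideanSpace ℝ (Fin N) → ℝ} (hΩ : Bornology.IsBounded Ω)
    (hφ : IsTestFun Ω φ) (hψ : IsTestFun Ω ψ) (hψ0 : ∀ x, 0 ≤ ψ x)
    {b : EuclideanSpace ℝ (Fin N) → ℝ} (hb : ContinuousOn b (closure Ω)) {p : ℝ} (hp : 0 < p) :
    Filter.Tendsto (fun δ => ∫ x in Ω, b x * |√(φ x ^ 2 + δ ^ 2) - δ + ψ x| ^ p)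
      (nhdsWithin 0 (Set.Ioi 0)) (nhds (∫ x in Ω, b x * (|φ x| + ψ x) ^ p)) := by
  have hcont : ∀ δ : ℝ, Continuous fun x => |√(φ x ^ 2 + δ ^ 2) - δ + ψ x| ^ p := fun δ =>
    (((((hφ.continuous.pow 2).add continuous_const).sqrt.sub continuous_const).add
      hψ.continuous).abs).rpow_const fun _ => Or.inr hp.le
  have hcont' : Continuous fun x => (|φ x| + ψ x) ^ p :=
    (hφ.continuous.abs.add hψ.continuous).rpow_const fun _ => Or.inr hp.le
  refine tendsto_integral_filter_of_dominated_convergence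
    (fun x => ‖b x * (|φ x| + ψ x) ^ p‖) (Filter.Eventually.of_forall fun δ =>
      ((hb.mul (hcont δ).continuousOn).integrableOn_of_isBounded hΩ).aestronglyMeasurable) ?_
    ((hb.mul hcont'.continuousOn).integrableOn_of_isBounded hΩ).norm ?_
  · filter_upwards [self_mem_nhdsWithin] with δ hδ
    refine Filter.Eventually.of_forall fun x => ?_
    have hδ : 0 < δ := hδ
    have h1 : √(φ x ^ 2 + δ ^ 2) ≤ |φ x| + δ := by
      rw [Real.sqrt_le_left (by positivity)]
      nlinarith [sq_abs (φ x), abs_nonneg (φ x), mul_nonneg (abs_nonneg (φ x)) hδ.le]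
    have h2 : δ ≤ √(φ x ^ 2 + δ ^ 2) := Real.le_sqrt_of_sq_le (by nlinarith [sq_nonneg (φ x)])
    rw [norm_mul, norm_mul, Real.norm_of_nonneg (by positivity : (0:ℝ) ≤ _ ^ p),
      Real.norm_of_nonneg (Real.rpow_nonneg (add_nonneg (abs_nonneg _) (hψ0 x)) p)]
    gcongr
    rw [abs_of_nonneg (by linarith [hψ0 x])]
    linarith
  · refine Filter.Eventually.of_forall fun x => ?_
    have hc : Continuous fun δ : ℝ => b x * |√(φ x ^ 2 + δ ^ 2) - δ + ψ x| ^ p := by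
      refine continuous_const.mul (Continuous.rpow_const (by fun_prop) fun _ => Or.inr hp.le)
    have h := (hc.tendsto 0).mono_left (nhdsWithin_le_nhds (s := Set.Ioi 0))
    simpa [Real.sqrt_sq_eq_abs, abs_of_nonneg (add_nonneg (abs_nonneg (φ x)) (hψ0 x))] using h

theorem exists_perturbation {N : ℕ} {Ω : Set (EuclideanSpace ℝ (Fin N))}
    {φ ψ a : EuclideanSpace ℝ (Fin N) → ℝ} (hΩ : Bornology.IsBounded Ω)
    (ha : ContinuousOn a (closure Ω)) (hφ : IsTestFun Ω φ) (hψ : IsTestFun Ω ψ)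
    (hψ0 : ∀ x, 0 ≤ ψ x) (hψa : ∀ x, ψ x ≠ 0 → 0 < a x) {p t : ℝ} (hp : 1 < p) (ht : 0 < t)
    (hψp : 0 < ∫ x in Ω, |ψ x| ^ p) (hnorm : (∫ x in Ω, |φ x| ^ p) = 1)
    (hc : 0 < (∫ x in Ω, a x * |φ x| ^ p) + t ^ p * ∫ x in Ω, a x * |ψ x| ^ p) :
    ∃ χ : EuclideanSpace ℝ (Fin N) → ℝ, IsTestFun Ω χ ∧ (1 ≤ ∫ x in Ω, |χ x| ^ p) ∧
      (0 < ∫ x in Ω, a x * |χ x| ^ p) ∧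
      ∫ x in Ω, ‖gradient χ x‖ ^ p ≤ (1 + t) ^ (p - 1) *
        ((∫ x in Ω, ‖gradient φ x‖ ^ p) + t * ∫ x in Ω, ‖gradient ψ x‖ ^ p) := by
  have hp0 : 0 < p := by linarith
  have htψ := hψ.const_mul t
  have htψ0 : ∀ x, 0 ≤ t * ψ x := fun x => mul_nonneg ht.le (hψ0 x)
  have hcont : Continuous fun x => (|φ x| + t * ψ x) ^ p :=
    (hφ.continuous.abs.add htψ.continuous).rpow_const fun _ => Or.inr hp0.le
  have key : ∀ b : EuclideanSpace ℝ (Fin N) → ℝ, ContinuousOn b (closure Ω) →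
      (∀ x, ψ x ≠ 0 → 0 < b x) →
      (∫ x in Ω, b x * |φ x| ^ p) + t ^ p * (∫ x in Ω, b x * |ψ x| ^ p) ≤
        ∫ x in Ω, b x * (|φ x| + t * ψ x) ^ p := fun b hb hbpos => by
    rw [← integral_const_mul, ← integral_add (hφ.integrableOn_mul_abs_rpow hΩ hb hp0.le)
      ((hψ.integrableOn_mul_abs_rpow hΩ hb hp0.le).const_mul _)]
    refine integral_mono ((hφ.integrableOn_mul_abs_rpow hΩ hb hp0.le).add
      ((hψ.integrableOn_mul_abs_rpow hΩ hb hp0.le).const_mul _))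
      ((hb.mul hcont.continuousOn).integrableOn_of_isBounded hΩ) fun x => ?_
    by_cases hx : ψ x = 0
    · simp [hx, hp0.ne']
    · have hbx := hbpos x hx
      have h : |φ x| ^ p + (t * ψ x) ^ p ≤ (|φ x| + t * ψ x) ^ p := by
        exact_mod_cast NNReal.add_rpow_le_rpow_add ⟨|φ x|, abs_nonneg _⟩ ⟨t * ψ x, htψ0 x⟩ hp.le
      rw [Real.mul_rpow ht.le (hψ0 x)] at h
      calc b x * |φ x| ^ p + t ^ p * (b x * |ψ x| ^ p)
          = b x * (|φ x| ^ p + t ^ p * ψ x ^ p) := by rw [abs_of_nonneg (hψ0 x)]; ring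
        _ ≤ _ := by gcongr
  have ha' := hc.trans_le (key a ha hψa)
  have h1' : 1 < ∫ x in Ω, (|φ x| + t * ψ x) ^ p := by
    have h := key (fun _ => 1) continuousOn_const (by simp)
    simp only [one_mul, hnorm] at h
    have : 0 < t ^ p * ∫ x in Ω, |ψ x| ^ p := by positivity
    linarith
  have hlim1 := tendsto_integral_mul_abs_sqrt_rpow hΩ hφ htψ htψ0
    (b := fun _ => 1) continuousOn_const hp0
  simp only [one_mul] at hlim1
  obtain ⟨δ, hδa, hδ1, hδ⟩ := (((tendsto_integral_mul_abs_sqrt_rpow hΩ hφ htψ htψ0 ha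
    hp0).eventually (lt_mem_nhds ha')).and ((hlim1.eventually (lt_mem_nhds h1')).and
      self_mem_nhdsWithin)).exists
  have hδ : 0 < δ := hδ
  have hχ := (hφ.sqrt_sq_add_sq_sub hδ).add htψ
  refine ⟨_, hχ, hδ1.le, hδa, ?_⟩
  rw [← integral_const_mul t, ← integral_add (hφ.integrableOn_norm_gradient_rpow hΩ hp0.le)
    ((hψ.integrableOn_norm_gradient_rpow hΩ hp0.le).const_mul t), ← integral_const_mul]
  refine integral_mono (hχ.integrableOn_norm_gradient_rpow hΩ hp0.le)
    (((hφ.integrableOn_norm_gradient_rpow hΩ hp0.le).add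
      ((hψ.integrableOn_norm_gradient_rpow hΩ hp0.le).const_mul t)).const_mul _) fun x => ?_
  refine le_trans ?_ (rpow_add_mul_le (norm_nonneg _) (norm_nonneg _) ht.le hp.le)
  gcongr
  calc ‖gradient (fun x => √(φ x ^ 2 + δ ^ 2) - δ + t * ψ x) x‖
      ≤ ‖gradient (fun x => √(φ x ^ 2 + δ ^ 2) - δ) x‖ + ‖gradient (fun x => t * ψ x) x‖ := by
        rw [norm_gradient, norm_gradient, norm_gradient,
          fderiv_fun_add ((hφ.sqrt_sq_add_sq_sub hδ).differentiable x) (htψ.differentiable x)]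
        exact norm_add_le _ _
    _ ≤ ‖gradient φ x‖ + t * ‖gradient ψ x‖ := by
        rw [hψ.norm_gradient_const_mul, abs_of_pos ht]
        gcongr
        exact hφ.norm_gradient_sqrt_sq_add_sq_sub_le hδ x

theorem tendsto_integral_mul_abs_rpow_exponent {N : ℕ} {Ω : Set (EuclideanSpace ℝ (Fin N))}
    {φ a : EuclideanSpace ℝ (Fin N) → ℝ} (hΩ : Bornology.IsBounded Ω)
    (ha : ContinuousOn a (closure Ω)) (hφ : IsTestFun Ω φ) {p : ℝ} (hp : 0 < p) :
    Filter.Tendsto (fun q => ∫ x in Ω, a x * |φ x| ^ q) (nhdsWithin p (Set.Iio p))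
      (nhds (∫ x in Ω, a x * |φ x| ^ p)) := by
  have hev : ∀ᶠ q in nhdsWithin p (Set.Iio p), 0 ≤ q ∧ q ≤ p := by
    filter_upwards [nhdsWithin_le_nhds (lt_mem_nhds hp), self_mem_nhdsWithin] with q h1 h2
    exact ⟨le_of_lt h1, le_of_lt h2⟩
  refine tendsto_integral_filter_of_dominated_convergence
    (fun x => ‖a x * (1 + |φ x| ^ p)‖) ?_ ?_
    ((ha.mul (continuous_const.add
      (hφ.continuous_abs_rpow hp.le)).continuousOn).integrableOn_of_isBounded hΩ).norm ?_
  · filter_upwards [hev] with q hq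
    exact (hφ.integrableOn_mul_abs_rpow hΩ ha hq.1).aestronglyMeasurable
  · filter_upwards [hev] with q hq
    refine Filter.Eventually.of_forall fun x => ?_
    rw [norm_mul, norm_mul, Real.norm_of_nonneg (by positivity : (0:ℝ) ≤ |φ x| ^ q),
      Real.norm_of_nonneg (by positivity : (0:ℝ) ≤ 1 + |φ x| ^ p)]
    gcongr
    have hxp : 0 ≤ |φ x| ^ p := by positivity
    rcases le_total |φ x| 1 with h | h
    · linarith [Real.rpow_le_one (abs_nonneg (φ x)) h hq.1]
    · linarith [Real.rpow_le_rpow_of_exponent_le h hq.2]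
  · refine Filter.Eventually.of_forall fun x => ?_
    exact ((Real.continuousAt_const_rpow' hp.ne').tendsto.mono_left nhdsWithin_le_nhds).const_mul _

/-- `λ*(a,q) → λ*(a,p)` as `q → p⁻`. -/
theorem lambdaStar_continuous_from_left
    {N : ℕ} (hN : 1 ≤ N) (Ω : Set (EuclideanSpace ℝ (Fin N)))
    (hΩne : Ω.Nonempty) (hΩo : IsOpen Ω) (hΩb : Bornology.IsBounded Ω)
    (p : ℝ) (hp : 1 < p)
    (a : EuclideanSpace ℝ (Fin N) → ℝ) (ha : ContinuousOn a (closure Ω))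
    (haplus : ∃ x ∈ Ω, 0 < a x) (haminus : ∃ x ∈ Ω, a x < 0) :
    ∀ ε : ℝ, 0 < ε → ∃ δ : ℝ, 0 < δ ∧ ∀ q : ℝ, p - δ < q → q < p →
      |lambdaStar Ω p q a - lambdaStar Ω p p a| < ε := by
  intro ε hε
  have hp0 : 0 < p := by linarith
  obtain ⟨ψ, hψ, hψ0, hψa, hψp, hψap⟩ :=
    exists_isTestFun_support_subset_pos hΩo hΩb ha haplus hp0
  set L := lambdaStar Ω p p a with hL
  set D := ∫ x in Ω, ‖gradient ψ x‖ ^ p with hD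
  have hconstr : ∀ r : ℝ, 0 < r → 0 ≤ ∫ x in Ω, a x * |ψ x| ^ r :=
    fun r hr => integral_nonneg fun x => by
      by_cases hx : ψ x = 0
      · simp [hx, hr.ne']
      · have := hψa x hx
        simp only [Pi.zero_apply]
        positivity
  have upper : ∀ᶠ q in nhdsWithin p (Set.Iio p), lambdaStar Ω p q a < L + ε := by
    obtain ⟨_, ⟨φ, hφ, hnorm, hφa, rfl⟩, hφL⟩ := exists_lt_of_csInf_lt
      (⟨_, hψ.exists_normalized hp0 hψp hψap.le⟩) (show L < L + ε by linarith)
    have hlim : Filter.Tendsto (fun t : ℝ => (1 + t) ^ (p - 1) *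
        ((∫ x in Ω, ‖gradient φ x‖ ^ p) + t * D)) (nhdsWithin 0 (Set.Ioi 0))
        (nhds (∫ x in Ω, ‖gradient φ x‖ ^ p)) := by
      have hc : Continuous fun t : ℝ => (1 + t) ^ (p - 1) *
          ((∫ x in Ω, ‖gradient φ x‖ ^ p) + t * D) :=
        (Continuous.rpow_const (by fun_prop) fun _ => Or.inr (by linarith)).mul (by fun_prop)
      simpa using (hc.tendsto 0).mono_left (nhdsWithin_le_nhds (s := Set.Ioi 0))
    obtain ⟨t, htL, ht⟩ := ((hlim.eventually (gt_mem_nhds hφL)).and self_mem_nhdsWithin).exists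
    have ht : 0 < t := ht
    obtain ⟨χ, hχ, hχ1, hχa, hχE⟩ := exists_perturbation hΩb ha hφ hψ hψ0 hψa hp ht hψp hnorm
      (by positivity)
    filter_upwards [(tendsto_integral_mul_abs_rpow_exponent hΩb ha hχ hp0).eventually
      (lt_mem_nhds hχa)] with q hq
    exact ((lambdaStar_le hχ hp0 hχ1 hq.le).trans hχE).trans_lt htL
  have lower : ∀ᶠ q in nhdsWithin p (Set.Iio p), L - ε / 2 ≤ lambdaStar Ω p q a := by
    have hlim : Filter.Tendsto (fun t : ℝ => (1 + t) ^ (p - 1) * (L - ε / 2 + t * D))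
        (nhdsWithin 0 (Set.Ioi 0)) (nhds (L - ε / 2)) := by
      have hc : Continuous fun t : ℝ => (1 + t) ^ (p - 1) * (L - ε / 2 + t * D) :=
        (Continuous.rpow_const (by fun_prop) fun _ => Or.inr (by linarith)).mul (by fun_prop)
      simpa using (hc.tendsto 0).mono_left (nhdsWithin_le_nhds (s := Set.Ioi 0))
    obtain ⟨t, htL, ht⟩ := ((hlim.eventually
      (gt_mem_nhds (show L - ε / 2 < L by linarith))).and self_mem_nhdsWithin).exists
    have ht : 0 < t := ht
    obtain ⟨K, hK⟩ := exists_abs_integral_sub_integral_le hN hΩo hΩb ha hp L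
    have hgain : 0 < t ^ p * ∫ x in Ω, a x * |ψ x| ^ p := by positivity
    have hsmall : ∀ᶠ q in nhdsWithin p (Set.Iio p),
        (p - q) * K < t ^ p * ∫ x in Ω, a x * |ψ x| ^ p := by
      have hc : Continuous fun q : ℝ => (p - q) * K := by fun_prop
      exact nhdsWithin_le_nhds ((hc.tendsto p).eventually (gt_mem_nhds (by simpa using hgain)))
    filter_upwards [hsmall, nhdsWithin_le_nhds (lt_mem_nhds hp), self_mem_nhdsWithin]
      with q hqK hq1 hqp
    have hq1 : 1 < q := hq1
    have hqp : q < p := hqp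
    refine le_csInf ⟨_, hψ.exists_normalized hp0 hψp (hconstr q (by linarith))⟩ ?_
    rintro _ ⟨φ, hφ, hnorm, hφa, rfl⟩
    by_contra! hlt
    have hdiff := (abs_le.mp (hK q hq1.le hqp φ hφ hnorm (by linarith))).1
    obtain ⟨χ, hχ, hχ1, hχa, hχE⟩ := exists_perturbation hΩb ha hφ hψ hψ0 hψa hp ht hψp hnorm
      (by linarith)
    have hLχ : L ≤ _ := lambdaStar_le hχ hp0 hχ1 hχa.le
    have : (1 + t) ^ (p - 1) * ((∫ x in Ω, ‖gradient φ x‖ ^ p) + t * D) ≤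
        (1 + t) ^ (p - 1) * (L - ε / 2 + t * D) := by gcongr
    linarith
  obtain ⟨l, hl, hsub⟩ := (mem_nhdsLT_iff_exists_Ioo_subset).1 (upper.and lower)
  refine ⟨p - l, sub_pos.2 hl, fun q hq hqp => ?_⟩
  obtain ⟨h1, h2⟩ := hsub ⟨by linarith, hqp⟩
  rw [abs_lt]
  constructor <;> linarith
end
end

section
/- Suppose λ < λ*(a,q). Then there exists a constant K > 0 such that every Dirichlet weak subsolution u of (P_λ) with ∫_Ω a u^q > 0 satisfies u(x) ≤ K for every x ∈ Ω. -/
open MeasureTheory RealInnerProductSpace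

noncomputable section

/-- A Dirichlet weak subsolution of `(P_λ)`: as a Dirichlet weak solution, but the weak
equation is an inequality `≤` tested against nonnegative test functions. -/
def DirichletSubsol {N : ℕ} (Ω : Set (EuclideanSpace ℝ (Fin N))) (p q lam : ℝ)
    (a u : EuclideanSpace ℝ (Fin N) → ℝ) : Prop :=
  ContinuousOn u (closure Ω) ∧
  (∀ x ∈ Ω, DifferentiableAt ℝ u x) ∧
  ContinuousOn (fun x => gradient u x) Ω ∧
  (∀ x ∈ Ω, 0 ≤ u x) ∧
  (∀ x ∈ frontier Ω, u x = 0) ∧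
  IntegrableOn (fun x => ‖gradient u x‖ ^ p) Ω ∧
  ∀ φ : EuclideanSpace ℝ (Fin N) → ℝ, IsTestFun Ω φ → (∀ x, 0 ≤ φ x) →
    (∫ x in Ω, ‖gradient u x‖ ^ (p - 2) * ⟪gradient u x, gradient φ x⟫)
      ≤ ∫ x in Ω, (lam * u x ^ (p - 1) + a x * u x ^ (q - 1)) * φ x

open Filter Topology Set

/-- Mollification: a compactly supported `C¹` function is approximated, together with its
gradient, by test functions supported in a common compact set. -/
theorem exists_seq_isTestFun {N : ℕ} {Ω : Set (EuclideanSpace ℝ (Fin N))} (hΩ : IsOpen Ω)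
    {g : EuclideanSpace ℝ (Fin N) → ℝ} (hg : ContDiff ℝ 1 g) (hc : HasCompactSupport g)
    (hs : tsupport g ⊆ Ω) :
    ∃ (K : Set (EuclideanSpace ℝ (Fin N))) (C : ℝ) (φ : ℕ → EuclideanSpace ℝ (Fin N) → ℝ),
      IsCompact K ∧ K ⊆ Ω ∧ (∀ n, IsTestFun Ω (φ n)) ∧
      (∀ n, ∀ x ∉ K, gradient (φ n) x = 0) ∧
      (∀ n x, |φ n x| ≤ C) ∧ (∀ n x, ‖gradient (φ n) x‖ ≤ C) ∧
      (∀ x, Tendsto (fun n => φ n x) atTop (𝓝 (g x))) ∧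
      (∀ x, Tendsto (fun n => gradient (φ n) x) atTop (𝓝 (gradient g x))) ∧
      ((∀ x, 0 ≤ g x) → ∀ n x, 0 ≤ φ n x) := by
  obtain ⟨δ, hδ, hδΩ⟩ := hc.isCompact.exists_cthickening_subset_open hΩ hs
  let b : ℕ → ContDiffBump (0 : EuclideanSpace ℝ (Fin N)) := fun n =>
    ⟨δ / (2 * (n + 1)), δ / (n + 1), by positivity,
      by apply div_lt_div_of_pos_left hδ <;> [positivity; nlinarith [(n.cast_nonneg : (0:ℝ) ≤ n)]]⟩
  have hb : Tendsto (fun n => (b n).rOut) atTop (𝓝 0) := by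
    have := (tendsto_one_div_add_atTop_nhds_zero_nat (𝕜 := ℝ)).const_mul δ
    simpa [b, div_eq_mul_inv] using this
  have hbδ : ∀ n, (b n).rOut ≤ δ := fun n => by
    apply div_le_self hδ.le; linarith [(n.cast_nonneg : (0:ℝ) ≤ n)]
  let φ : ℕ → EuclideanSpace ℝ (Fin N) → ℝ := fun n =>
    convolution ((b n).normed volume) g (ContinuousLinearMap.lsmul ℝ ℝ) volume
  have hcont : Continuous g := hg.continuous
  have hcontd : Continuous (fderiv ℝ g) := hg.continuous_fderiv one_ne_zero
  have hK : IsCompact (Metric.cthickening δ (tsupport g)) := hc.isCompact.cthickening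
  have hsupp : ∀ n, tsupport (φ n) ⊆ Metric.cthickening δ (tsupport g) := fun n => by
    apply closure_minimal _ Metric.isClosed_cthickening
    refine (support_convolution_subset _).trans ?_
    rw [(b n).support_normed_eq]
    rintro _ ⟨y, hy, z, hz, rfl⟩
    refine Metric.mem_cthickening_of_dist_le _ z _ _ (subset_tsupport _ hz) ?_
    simp only [Metric.mem_ball, dist_zero_right] at hy
    simpa using hy.le.trans (hbδ n)
  have hfd : ∀ n x, fderiv ℝ (φ n) x = convolution ((b n).normed volume) (fderiv ℝ g)
      (ContinuousLinearMap.lsmul ℝ ℝ) volume x := fun n x => by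
    have := hc.hasFDerivAt_convolution_right (ContinuousLinearMap.lsmul ℝ ℝ)
      (f := (b n).normed volume) (μ := volume)
      ((b n).continuous_normed.locallyIntegrable) hg x
    rw [this.fderiv]
    rfl
  obtain ⟨C₁, hC₁⟩ := hcont.bounded_above_of_compact_support hc
  obtain ⟨C₂, hC₂⟩ := hcontd.bounded_above_of_compact_support (hc.fderiv (𝕜 := ℝ))
  have key1 : ∀ n x, |φ n x| ≤ 3 * C₁ := fun n x => by
    have h := ContDiffBump.dist_normed_convolution_le (φ := b n) (μ := volume) (x₀ := x)
      (ε := 2 * C₁) hcont.aestronglyMeasurable fun y _ => by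
        rw [dist_eq_norm]; linarith [norm_sub_le (g y) (g x), hC₁ y, hC₁ x]
    rw [dist_eq_norm] at h
    have h2 := norm_le_insert' (φ n x) (g x)
    rw [← Real.norm_eq_abs]
    linarith [hC₁ x]
  have key2 : ∀ n x, ‖fderiv ℝ (φ n) x‖ ≤ 3 * C₂ := fun n x => by
    have h := ContDiffBump.dist_normed_convolution_le (φ := b n) (μ := volume) (x₀ := x)
      (ε := 2 * C₂) (g := fderiv ℝ g) hcontd.aestronglyMeasurable fun y _ => by
        rw [dist_eq_norm]; linarith [norm_sub_le (fderiv ℝ g y) (fderiv ℝ g x), hC₂ y, hC₂ x]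
    rw [dist_eq_norm, ← hfd] at h
    have h2 := norm_le_insert' (fderiv ℝ (φ n) x) (fderiv ℝ g x)
    linarith [hC₂ x]
  refine ⟨Metric.cthickening δ (tsupport g), max (3 * C₁) (3 * C₂), φ, hK, hδΩ, ?_, ?_, ?_, ?_,
    ?_, ?_, ?_⟩
  · refine fun n => ⟨?_, hK.of_isClosed_subset (isClosed_tsupport _) (hsupp n),
      (hsupp n).trans hδΩ⟩
    exact (b n).hasCompactSupport_normed.contDiff_convolution_left _ (b n).contDiff_normed
      hcont.locallyIntegrable
  · intro n x hx
    have : fderiv ℝ (φ n) x = 0 := by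
      by_contra h
      exact hx (hsupp n (support_fderiv_subset ℝ h))
    simp [gradient, this]
  · exact fun n x => (key1 n x).trans (le_max_left _ _)
  · intro n x
    rw [gradient, LinearIsometryEquiv.norm_map]
    exact (key2 n x).trans (le_max_right _ _)
  · exact fun x => ContDiffBump.convolution_tendsto_right_of_continuous hb hcont x
  · intro x
    have := ContDiffBump.convolution_tendsto_right_of_continuous (μ := volume) hb hcontd x
    simp only [gradient, hfd]
    exact (LinearIsometryEquiv.continuous _).continuousAt.tendsto.comp this
  · intro h n x
    exact integral_nonneg fun t => mul_nonneg ((b n).nonneg_normed _) (h _)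

theorem continuous_gradient {N : ℕ} {g : EuclideanSpace ℝ (Fin N) → ℝ} (hg : ContDiff ℝ 1 g) :
    Continuous (gradient g) :=
  (LinearIsometryEquiv.continuous _).comp (hg.continuous_fderiv one_ne_zero)

theorem lambdaStar_mul_le_of_isTestFun {N : ℕ} {Ω : Set (EuclideanSpace ℝ (Fin N))}
    {p q : ℝ} (hp : 0 < p) (hq : 0 < q) {a φ : EuclideanSpace ℝ (Fin N) → ℝ}
    (hφ : IsTestFun Ω φ) (hpos : 0 < ∫ x in Ω, a x * |φ x| ^ q) :
    lambdaStar Ω p q a * (∫ x in Ω, |φ x| ^ p) ≤ ∫ x in Ω, ‖gradient φ x‖ ^ p := by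
  have hcont : Continuous φ := hφ.1.continuous
  have hint : Integrable (fun x => |φ x| ^ p) := by
    refine (hcont.abs.rpow_const fun _ => Or.inr hp.le).integrable_of_hasCompactSupport ?_
    exact hφ.2.1.comp_left (g := fun t : ℝ => |t| ^ p) (by simp [hp.ne'])
  have hX : 0 < ∫ x in Ω, |φ x| ^ p := by
    refine (integral_nonneg fun x => by positivity).lt_of_ne fun h => hpos.ne' ?_
    have h0 := (integral_eq_zero_iff_of_nonneg (fun x => by positivity)
      hint.integrableOn).1 h.symm
    rw [integral_eq_zero_of_ae]
    filter_upwards [h0] with x hx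
    have : φ x = 0 := by
      have := (Real.rpow_eq_zero (abs_nonneg _) hp.ne').1 hx
      simpa using this
    simp [this, hq.ne']
  set X := ∫ x in Ω, |φ x| ^ p with hXdef
  set c := X ^ (-1 / p) with hcdef
  have hc : 0 < c := by positivity
  have hcp : c ^ p = X⁻¹ := by
    rw [hcdef, ← Real.rpow_mul hX.le, div_mul_cancel₀ _ hp.ne', Real.rpow_neg_one]
  have hle : lambdaStar Ω p q a ≤ ∫ x in Ω, ‖gradient (fun y => c * φ y) x‖ ^ p := by
    refine csInf_le ⟨0, ?_⟩ ⟨fun y => c * φ y, ⟨contDiff_const.mul hφ.1, hφ.2.1.mul_left, ?_⟩,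
      ?_, ?_, rfl⟩
    · rintro _ ⟨ψ, -, -, -, rfl⟩
      exact integral_nonneg fun x => by positivity
    · exact (closure_mono (Function.support_mul_subset_right _ _)).trans hφ.2.2
    · simp_rw [abs_mul, Real.mul_rpow (abs_nonneg _) (abs_nonneg _), integral_const_mul]
      rw [abs_of_pos hc, hcp, ← hXdef, inv_mul_cancel₀ hX.ne']
    · simp_rw [abs_mul, Real.mul_rpow (abs_nonneg _) (abs_nonneg _), mul_left_comm (a _),
        integral_const_mul]
      positivity
  have hgr : ∀ x, gradient (fun y => c * φ y) x = c • gradient φ x := fun x => by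
    simp only [gradient]
    rw [fderiv_const_mul (hφ.1.differentiable (by simp) x)]
    simp
  simp_rw [hgr, norm_smul, Real.norm_eq_abs, abs_of_pos hc,
    Real.mul_rpow hc.le (norm_nonneg _), integral_const_mul] at hle
  rw [hcp, inv_mul_eq_div, le_div_iff₀ hX] at hle
  exact hle

theorem lambdaStar_mul_le {N : ℕ} {Ω : Set (EuclideanSpace ℝ (Fin N))}
    (hΩo : IsOpen Ω) (hΩb : Bornology.IsBounded Ω) {p q : ℝ} (hp : 0 < p) (hq : 0 < q)
    {a g : EuclideanSpace ℝ (Fin N) → ℝ} (ha : ContinuousOn a (closure Ω))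
    (hg : ContDiff ℝ 1 g) (hc : HasCompactSupport g) (hs : tsupport g ⊆ Ω)
    (hpos : 0 < ∫ x in Ω, a x * |g x| ^ q) :
    lambdaStar Ω p q a * (∫ x in Ω, |g x| ^ p) ≤ ∫ x in Ω, ‖gradient g x‖ ^ p := by
  obtain ⟨K, C, φ, -, -, hφ, -, hb, hbd, ht, htd, -⟩ := exists_seq_isTestFun hΩo hg hc hs
  have : Fact (volume Ω < ⊤) := ⟨hΩb.measure_lt_top⟩
  obtain ⟨A, hA⟩ := hΩb.isCompact_closure.exists_bound_of_continuousOn ha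
  have ham : AEStronglyMeasurable a (volume.restrict Ω) :=
    (ha.mono subset_closure).aestronglyMeasurable hΩo.measurableSet
  have t1 : Tendsto (fun n => ∫ x in Ω, |φ n x| ^ p) atTop (𝓝 (∫ x in Ω, |g x| ^ p)) := by
    refine tendsto_integral_of_dominated_convergence (fun _ => C ^ p) (fun n => ?_)
      (integrable_const _) (fun n => .of_forall fun x => ?_) (.of_forall fun x => ?_)
    · exact ((hφ n).1.continuous.abs.rpow_const fun _ => Or.inr hp.le).aestronglyMeasurable
    · rw [Real.norm_of_nonneg (by positivity)]
      exact Real.rpow_le_rpow (abs_nonneg _) (hb n x) hp.le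
    · exact (ht x).abs.rpow_const (Or.inr hp.le)
  have t2 : Tendsto (fun n => ∫ x in Ω, ‖gradient (φ n) x‖ ^ p) atTop
      (𝓝 (∫ x in Ω, ‖gradient g x‖ ^ p)) := by
    refine tendsto_integral_of_dominated_convergence (fun _ => C ^ p) (fun n => ?_)
      (integrable_const _) (fun n => .of_forall fun x => ?_) (.of_forall fun x => ?_)
    · exact ((continuous_gradient ((hφ n).1.of_le (by simp))).norm.rpow_const
        fun _ => Or.inr hp.le).aestronglyMeasurable
    · rw [Real.norm_of_nonneg (by positivity)]
      exact Real.rpow_le_rpow (norm_nonneg _) (hbd n x) hp.le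
    · exact (htd x).norm.rpow_const (Or.inr hp.le)
  have t3 : Tendsto (fun n => ∫ x in Ω, a x * |φ n x| ^ q) atTop
      (𝓝 (∫ x in Ω, a x * |g x| ^ q)) := by
    refine tendsto_integral_of_dominated_convergence (fun _ => A * C ^ q) (fun n => ?_)
      (integrable_const _) (fun n => ?_) (.of_forall fun x => ?_)
    · exact ham.mul
        ((hφ n).1.continuous.abs.rpow_const fun _ => Or.inr hq.le).aestronglyMeasurable
    · filter_upwards [ae_restrict_mem hΩo.measurableSet] with x hx
      rw [norm_mul, Real.norm_of_nonneg (by positivity : 0 ≤ |φ n x| ^ q)]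
      have h1 := hA x (subset_closure hx)
      exact mul_le_mul h1 (Real.rpow_le_rpow (abs_nonneg _) (hb n x) hq.le) (by positivity)
        ((norm_nonneg _).trans h1)
    · exact ((ht x).abs.rpow_const (Or.inr hq.le)).const_mul _
  refine le_of_tendsto_of_tendsto (t1.const_mul _) t2 ?_
  filter_upwards [t3.eventually (lt_mem_nhds hpos)] with n hn
  exact lambdaStar_mul_le_of_isTestFun hp hq (hφ n) hn

theorem rpow_sub_two_mul_self {p t : ℝ} (hp : 1 < p) (ht : 0 ≤ t) :
    t ^ (p - 2) * t = t ^ (p - 1) := by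
  rcases ht.eq_or_lt with rfl | ht
  · rw [mul_zero, Real.zero_rpow (by linarith)]
  · rw [← Real.rpow_add_one ht.ne']
    ring_nf

theorem DirichletSubsol.test {N : ℕ} {Ω : Set (EuclideanSpace ℝ (Fin N))}
    (hΩo : IsOpen Ω) (hΩb : Bornology.IsBounded Ω) {p q lam : ℝ} (hp : 1 < p) (hq : 1 < q)
    {a u g : EuclideanSpace ℝ (Fin N) → ℝ} (ha : ContinuousOn a (closure Ω))
    (hu : DirichletSubsol Ω p q lam a u)
    (hg : ContDiff ℝ 1 g) (hc : HasCompactSupport g) (hs : tsupport g ⊆ Ω) (h0 : ∀ x, 0 ≤ g x) :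
    (∫ x in Ω, ‖gradient u x‖ ^ (p - 2) * ⟪gradient u x, gradient g x⟫)
      ≤ ∫ x in Ω, (lam * u x ^ (p - 1) + a x * u x ^ (q - 1)) * g x := by
  obtain ⟨K, C, φ, hK, hKΩ, hφ, hφK, hb, hbd, ht, htd, hnn⟩ := exists_seq_isTestFun hΩo hg hc hs
  obtain ⟨huc, hud, hug, -, -, -, hw⟩ := hu
  have : Fact (volume Ω < ⊤) := ⟨hΩb.measure_lt_top⟩
  have hf : ContinuousOn (fun x => lam * u x ^ (p - 1) + a x * u x ^ (q - 1)) (closure Ω) :=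
    (continuousOn_const.mul (huc.rpow_const fun _ _ => Or.inr (by linarith))).add
      (ha.mul (huc.rpow_const fun _ _ => Or.inr (by linarith)))
  obtain ⟨B, hB⟩ := hΩb.isCompact_closure.exists_bound_of_continuousOn hf
  have hgm : AEStronglyMeasurable (gradient u) (volume.restrict Ω) :=
    hug.aestronglyMeasurable hΩo.measurableSet
  have hcd : ∀ n, Continuous (gradient (φ n)) := fun n =>
    continuous_gradient ((hφ n).1.of_le (by simp))
  refine le_of_tendsto_of_tendsto' (tendsto_integral_of_dominated_convergence
    (K.indicator fun x => ‖gradient u x‖ ^ (p - 1) * C) (fun n => ?_) ?_ (fun n => ?_)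
    (.of_forall fun x => ?_)) (tendsto_integral_of_dominated_convergence
    (fun _ => B * C) (fun n => ?_) (integrable_const _) (fun n => ?_) (.of_forall fun x => ?_))
    fun n => hw (φ n) (hφ n) (hnn h0 n)
  · exact ((hgm.norm.aemeasurable.pow_const _).aestronglyMeasurable).mul
      (hgm.inner (hcd n).aestronglyMeasurable)
  · refine IntegrableOn.integrable_indicator ?_ hK.measurableSet
    refine IntegrableOn.mono_measure ?_ Measure.restrict_le_self
    refine ContinuousOn.integrableOn_compact hK ?_
    exact ((hug.mono hKΩ).norm.rpow_const fun _ _ => Or.inr (by linarith)).mul continuousOn_const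
  · refine .of_forall fun x => ?_
    by_cases hx : x ∈ K
    · rw [indicator_of_mem hx, norm_mul, Real.norm_of_nonneg (by positivity),
        ← rpow_sub_two_mul_self hp (norm_nonneg _), mul_assoc]
      gcongr
      exact (norm_inner_le_norm _ _).trans (by gcongr; exact hbd n x)
    · simp [hφK n x hx, indicator_of_notMem hx]
  · exact (tendsto_const_nhds.inner (htd x)).const_mul _
  · exact ((hf.mono subset_closure).aestronglyMeasurable hΩo.measurableSet).mul
      (hφ n).1.continuous.aestronglyMeasurable
  · filter_upwards [ae_restrict_mem hΩo.measurableSet] with x hx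
    have h1 := hB x (subset_closure hx)
    rw [norm_mul]
    exact mul_le_mul h1 (hb n x) (norm_nonneg _) ((norm_nonneg _).trans h1)
  · exact (ht x).const_mul _

theorem hasDerivAt_comp_max_sub {H H' : ℝ → ℝ} (hH : ∀ s, 0 ≤ s → HasDerivAt H (H' s) s)
    (h0' : H' 0 = 0) (k t : ℝ) :
    HasDerivAt (fun t => H (max (t - k) 0)) (H' (max (t - k) 0)) t := by
  have hleft : ∀ t ≤ k, HasDerivWithinAt (fun t => H (max (t - k) 0)) (H' (max (t - k) 0))
      (Iic k) t := fun t ht => by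
    rw [max_eq_right (by linarith), h0']
    exact (hasDerivWithinAt_const t (Iic k) (H 0)).congr
      (fun s hs => by rw [max_eq_right (by linarith [mem_Iic.1 hs])])
      (by rw [max_eq_right (by linarith)])
  have hright : ∀ t, k ≤ t → HasDerivWithinAt (fun t => H (max (t - k) 0)) (H' (max (t - k) 0))
      (Ici k) t := fun t ht => by
    rw [max_eq_left (by linarith)]
    exact ((hH (t - k) (by linarith)).comp_sub_const t k).hasDerivWithinAt.congr
      (fun s hs => by rw [max_eq_left (by linarith [mem_Ici.1 hs])])
      (by rw [max_eq_left (by linarith)])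
  rcases lt_trichotomy t k with h | rfl | h
  · exact (hleft t h.le).hasDerivAt (Iic_mem_nhds h)
  · have := (hleft t le_rfl).union (hright t le_rfl)
    rwa [Iic_union_Ici, hasDerivWithinAt_univ] at this
  · exact (hright t h.le).hasDerivAt (Ici_mem_nhds h)

/-- A `C¹` function of the truncation `(u - k)⁺`, `k > 0`, of a `C¹` function `u` vanishing on
the boundary is a compactly supported `C¹` function. -/
theorem truncation_regularity {N : ℕ} {Ω : Set (EuclideanSpace ℝ (Fin N))}
    (hΩo : IsOpen Ω) (hΩb : Bornology.IsBounded Ω) {u : EuclideanSpace ℝ (Fin N) → ℝ}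
    (huc : ContinuousOn u (closure Ω)) (hud : ∀ x ∈ Ω, DifferentiableAt ℝ u x)
    (hug : ContinuousOn (fun x => gradient u x) Ω) (hub : ∀ x ∈ frontier Ω, u x = 0)
    {H H' : ℝ → ℝ} (hH : ∀ s, 0 ≤ s → HasDerivAt H (H' s) s) (hH' : ContinuousOn H' (Ici 0))
    (h0 : H 0 = 0) (h0' : H' 0 = 0) {k : ℝ} (hk : 0 < k) :
    ContDiff ℝ 1 (Ω.indicator fun x => H (max (u x - k) 0)) ∧
    HasCompactSupport (Ω.indicator fun x => H (max (u x - k) 0)) ∧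
    tsupport (Ω.indicator fun x => H (max (u x - k) 0)) ⊆ Ω ∧
    (∀ x ∈ Ω, gradient (Ω.indicator fun x => H (max (u x - k) 0)) x =
      H' (max (u x - k) 0) • gradient u x) := by
  set g := Ω.indicator fun x => H (max (u x - k) 0) with hgdef
  have hclosed : IsClosed (closure Ω ∩ u ⁻¹' Ici k) :=
    huc.preimage_isClosed_of_isClosed isClosed_closure isClosed_Ici
  have hts : tsupport g ⊆ closure Ω ∩ u ⁻¹' Ici k := by
    refine closure_minimal (fun x hx => ?_) hclosed
    have hxΩ : x ∈ Ω := by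
      by_contra h
      exact hx (indicator_of_notMem h _)
    refine ⟨subset_closure hxΩ, ?_⟩
    by_contra h
    apply hx
    rw [hgdef, indicator_of_mem hxΩ, max_eq_right, h0]
    simp only [mem_preimage, mem_Ici, not_le] at h
    linarith
  have htsΩ : tsupport g ⊆ Ω := fun x hx => by
    obtain ⟨h1, h2⟩ := hts hx
    by_contra h
    have := hub x ⟨h1, by rwa [hΩo.interior_eq]⟩
    simp only [mem_preimage, mem_Ici, this] at h2
    linarith
  have hcs : HasCompactSupport g :=
    hΩb.isCompact_closure.of_isClosed_subset (isClosed_tsupport _) fun x hx => (hts hx).1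
  have hev : ∀ x ∈ Ω, g =ᶠ[𝓝 x] fun x => H (max (u x - k) 0) := fun x hx => by
    filter_upwards [hΩo.mem_nhds hx] with y hy
    rw [hgdef, indicator_of_mem hy]
  have hfd : ∀ x ∈ Ω, HasFDerivAt g (H' (max (u x - k) 0) • fderiv ℝ u x) x := fun x hx =>
    HasFDerivAt.congr_of_eventuallyEq
      ((hasDerivAt_comp_max_sub hH h0' k (u x)).comp_hasFDerivAt x (hud x hx).hasFDerivAt)
      (hev x hx)
  have hfdn : ∀ x ∉ tsupport g, HasFDerivAt g (0 : EuclideanSpace ℝ (Fin N) →L[ℝ] ℝ) x :=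
    fun x hx => (hasFDerivAt_const (0 : ℝ) x).congr_of_eventuallyEq
      (notMem_tsupport_iff_eventuallyEq.1 hx)
  have hfu : ContinuousOn (fderiv ℝ u) Ω := by
    have := (LinearIsometryEquiv.continuous
      (InnerProductSpace.toDual ℝ (EuclideanSpace ℝ (Fin N)))).comp_continuousOn hug
    exact this.congr fun x _ => by simp
  refine ⟨contDiff_one_iff_fderiv.2 ⟨fun x => ?_, continuous_iff_continuousAt.2 fun x => ?_⟩,
    hcs, htsΩ, fun x hx => ?_⟩
  · by_cases hx : x ∈ tsupport g
    · exact (hfd x (htsΩ hx)).differentiableAt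
    · exact (hfdn x hx).differentiableAt
  · by_cases hx : x ∈ tsupport g
    · have hxΩ := htsΩ hx
      have hcont : ContinuousOn (fun x => H' (max (u x - k) 0) • fderiv ℝ u x) Ω := by
        refine ContinuousOn.smul (hH'.comp ?_ fun y _ => mem_Ici.2 (le_max_right _ _)) hfu
        exact (((huc.mono subset_closure).sub continuousOn_const).sup continuousOn_const)
      refine (hcont.continuousAt (hΩo.mem_nhds hxΩ)).congr ?_
      filter_upwards [hΩo.mem_nhds hxΩ] with y hy using (hfd y hy).fderiv.symm
    · refine (continuousAt_const (y := (0 : EuclideanSpace ℝ (Fin N) →L[ℝ] ℝ))).congr ?_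
      filter_upwards [(isClosed_tsupport g).isOpen_compl.mem_nhds hx] with y hy
        using (hfdn y hy).fderiv.symm
  · simp [gradient, (hfd x hx).fderiv]

theorem enorm_le_lintegral_fderiv_of_dim_one {g : EuclideanSpace ℝ (Fin 1) → ℝ}
    (hg : ContDiff ℝ 1 g) (hc : HasCompactSupport g) (x : EuclideanSpace ℝ (Fin 1)) :
    ‖g x‖ₑ ≤ ∫⁻ y, ‖fderiv ℝ g y‖ₑ := by
  let L : ℝ ≃ₗᵢ[ℝ] EuclideanSpace ℝ (Fin 1) := (OrthonormalBasis.singleton (Fin 1) ℝ).repr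
  have hmp : MeasurePreserving L volume volume := L.measurePreserving
  have hmeas : Measurable fun y => ‖fderiv ℝ g y‖ₑ :=
    (hg.continuous_fderiv one_ne_zero).enorm.measurable
  have hLc : ContDiff ℝ 1 (fun s => g (L s)) := hg.comp L.contDiff
  have hcc : HasCompactSupport (fun s => g (L s)) := hc.comp_homeomorph L.toHomeomorph
  calc ‖g x‖ₑ = ‖g (L (L.symm x))‖ₑ := by rw [L.apply_symm_apply]
    _ ≤ ∫⁻ y in Iic (L.symm x), ‖deriv (fun s => g (L s)) y‖ₑ :=
      hcc.enorm_le_lintegral_Ici_deriv hLc _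
    _ ≤ ∫⁻ y, ‖deriv (fun s => g (L s)) y‖ₑ := setLIntegral_le_lintegral _ _
    _ ≤ ∫⁻ y, ‖fderiv ℝ g (L y)‖ₑ := by
      refine lintegral_mono fun y => ?_
      have h1 : HasDerivAt (fun s => g (L s)) (fderiv ℝ g (L y) (L 1)) y := by
        have h2 : HasDerivAt (fun s => L s) (L 1) y := by
          simpa using L.toContinuousLinearEquiv.hasFDerivAt.hasDerivAt (x := y)
        exact (hg.differentiable one_ne_zero (L y)).hasFDerivAt.comp_hasDerivAt y h2
      rw [h1.deriv, enorm_le_iff_norm_le]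
      refine (ContinuousLinearMap.le_opNorm _ _).trans ?_
      simp
    _ = ∫⁻ y, ‖fderiv ℝ g y‖ₑ := hmp.lintegral_comp hmeas

/-- A weak-type Sobolev inequality on bounded sets. -/
theorem weak_type_sobolev {N : ℕ} (hN : 1 ≤ N) {Ω : Set (EuclideanSpace ℝ (Fin N))}
    (hΩb : Bornology.IsBounded Ω) :
    ∃ θ C : ℝ, 1 < θ ∧ 0 ≤ C ∧ ∀ g : EuclideanSpace ℝ (Fin N) → ℝ, ContDiff ℝ 1 g →
      HasCompactSupport g → tsupport g ⊆ Ω → ∀ t : ℝ, 0 < t →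
      t ^ θ * volume.real {x ∈ Ω | t ≤ g x} ≤ C * (∫ x in Ω, ‖gradient g x‖) ^ θ := by
  have hI : ∀ g : EuclideanSpace ℝ (Fin N) → ℝ, ContDiff ℝ 1 g → HasCompactSupport g →
      tsupport g ⊆ Ω →
      ∫⁻ x, ‖fderiv ℝ g x‖ₑ = ENNReal.ofReal (∫ x in Ω, ‖gradient g x‖) := by
    intro g hg hc hs
    have hnorm : ∀ x, ‖gradient g x‖ = ‖fderiv ℝ g x‖ := fun x => by
      rw [gradient, LinearIsometryEquiv.norm_map]
    simp_rw [hnorm]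
    rw [setIntegral_eq_integral_of_forall_compl_eq_zero, ofReal_integral_norm_eq_lintegral_enorm]
    · exact (hg.continuous_fderiv one_ne_zero).integrable_of_hasCompactSupport (hc.fderiv _)
    · intro x hx
      rw [norm_eq_zero]
      by_contra h
      exact hx (hs (support_fderiv_subset ℝ h))
  rcases hN.eq_or_lt with rfl | hN
  · refine ⟨2, volume.real Ω, one_lt_two, measureReal_nonneg, fun g hg hc hs t ht => ?_⟩
    have hI0 : 0 ≤ ∫ x in Ω, ‖gradient g x‖ := integral_nonneg fun _ => norm_nonneg _
    rcases {x ∈ Ω | t ≤ g x}.eq_empty_or_nonempty with h | ⟨x, -, hx⟩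
    · rw [h]
      simp only [measureReal_empty, mul_zero]
      positivity
    · have h1 := enorm_le_lintegral_fderiv_of_dim_one hg hc x
      rw [hI g hg hc hs, ← ofReal_norm, ENNReal.ofReal_le_ofReal_iff hI0] at h1
      have h2 : t ≤ ∫ x in Ω, ‖gradient g x‖ := hx.trans ((le_abs_self _).trans h1)
      rw [mul_comm]
      exact mul_le_mul (measureReal_mono (fun y hy => hy.1) hΩb.measure_lt_top.ne)
        (Real.rpow_le_rpow ht.le h2 zero_le_two) (by positivity) (by positivity)
  · have hN' : (1 : ℝ) < N := by exact_mod_cast hN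
    have hconj : (N : ℝ).HolderConjugate (N : ℝ).conjExponent := .conjExponent hN'
    set θ := (N : ℝ).conjExponent
    refine ⟨θ, lintegralPowLePowLIntegralFDerivConst
      (volume : Measure (EuclideanSpace ℝ (Fin N))) θ, hconj.symm.lt, NNReal.coe_nonneg _,
      fun g hg hc hs t ht => ?_⟩
    have hI0 : 0 ≤ ∫ x in Ω, ‖gradient g x‖ := integral_nonneg fun _ => norm_nonneg _
    have hθ : 0 < θ := hconj.symm.pos
    have h1 := lintegral_pow_le_pow_lintegral_fderiv
      (volume : Measure (EuclideanSpace ℝ (Fin N))) hg hc (p := θ) (by simpa using hconj)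
    rw [hI g hg hc hs, ENNReal.ofReal_rpow_of_nonneg hI0 hθ.le] at h1
    have h2 := mul_meas_ge_le_lintegral₀ (μ := volume) (f := fun x => ‖g x‖ₑ ^ θ)
      (hg.continuous.enorm.measurable.pow_const θ).aemeasurable (ENNReal.ofReal (t ^ θ))
    have h3 : volume {x ∈ Ω | t ≤ g x} ≤
        volume {x | ENNReal.ofReal (t ^ θ) ≤ ‖g x‖ₑ ^ θ} := by
      refine measure_mono fun x hx => ?_
      rw [mem_ofPred_eq, ← ENNReal.ofReal_rpow_of_nonneg ht.le hθ.le, ← ofReal_norm]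
      gcongr
      exact hx.2.trans (le_abs_self _)
    have h4 : ENNReal.ofReal (t ^ θ) * volume {x ∈ Ω | t ≤ g x} ≤
        (lintegralPowLePowLIntegralFDerivConst
          (volume : Measure (EuclideanSpace ℝ (Fin N))) θ) *
          ENNReal.ofReal ((∫ x in Ω, ‖gradient g x‖) ^ θ) :=
      (by gcongr : _ ≤ _).trans (h2.trans h1)
    have h5 := ENNReal.toReal_mono (ENNReal.mul_ne_top ENNReal.coe_ne_top ENNReal.ofReal_ne_top) h4
    rwa [ENNReal.toReal_mul, ENNReal.toReal_mul, ENNReal.toReal_ofReal (by positivity),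
      ENNReal.toReal_ofReal (by positivity)] at h5

theorem integrableOn_of_continuousOn_closure {N : ℕ} {Ω : Set (EuclideanSpace ℝ (Fin N))}
    (hΩb : Bornology.IsBounded Ω) {f : EuclideanSpace ℝ (Fin N) → ℝ}
    (hf : ContinuousOn f (closure Ω)) : IntegrableOn f Ω :=
  (hf.integrableOn_compact hΩb.isCompact_closure).mono_set subset_closure

theorem DirichletSubsol.test_truncation {N : ℕ} {Ω : Set (EuclideanSpace ℝ (Fin N))}
    (hΩo : IsOpen Ω) (hΩb : Bornology.IsBounded Ω) {p q lam : ℝ} (hp : 1 < p) (hq : 1 < q)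
    {a u : EuclideanSpace ℝ (Fin N) → ℝ} (ha : ContinuousOn a (closure Ω))
    (hu : DirichletSubsol Ω p q lam a u) {H H' : ℝ → ℝ}
    (hH : ∀ s, 0 ≤ s → HasDerivAt H (H' s) s) (hH' : ContinuousOn H' (Ici 0))
    (h0 : H 0 = 0) (h0' : H' 0 = 0) (hnn : ∀ s, 0 ≤ s → 0 ≤ H s) {k : ℝ} (hk : 0 < k) :
    (∫ x in Ω, H' (max (u x - k) 0) * ‖gradient u x‖ ^ p)
      ≤ ∫ x in Ω, (lam * u x ^ (p - 1) + a x * u x ^ (q - 1)) * H (max (u x - k) 0) := by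
  obtain ⟨hg, hc, hs, hgr⟩ := truncation_regularity hΩo hΩb hu.1 hu.2.1 hu.2.2.1 hu.2.2.2.2.1
    hH hH' h0 h0' hk
  have h := hu.test hΩo hΩb hp hq ha hg hc hs fun x =>
    indicator_nonneg (fun x _ => hnn _ (le_max_right _ _)) x
  convert h using 1 <;> refine setIntegral_congr_fun hΩo.measurableSet fun x hx => ?_
  · rw [hgr x hx, inner_smul_right, real_inner_self_eq_norm_sq, mul_left_comm, sq, ← mul_assoc
      (_ ^ (p - 2)), rpow_sub_two_mul_self hp (norm_nonneg _)]
    congr 1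
    rcases (norm_nonneg (gradient u x)).eq_or_lt with h | h
    · rw [← h, mul_zero, Real.zero_rpow (by linarith)]
    · rw [← Real.rpow_add_one h.ne', sub_add_cancel]
  · simp only [indicator_of_mem hx]

theorem DirichletSubsol.lambdaStar_mul_le {N : ℕ} {Ω : Set (EuclideanSpace ℝ (Fin N))}
    (hΩo : IsOpen Ω) (hΩb : Bornology.IsBounded Ω) {p q lam : ℝ} (hp : 1 < p) (hq : 1 < q)
    {a u : EuclideanSpace ℝ (Fin N) → ℝ} (ha : ContinuousOn a (closure Ω))
    (hu : DirichletSubsol Ω p q lam a u) (hpos : 0 < ∫ x in Ω, a x * u x ^ q) :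
    lambdaStar Ω p q a * (∫ x in Ω, u x ^ p) ≤ ∫ x in Ω, (lam * u x ^ p + a x * u x ^ q) := by
  obtain ⟨huc, hud, hug, hnn, hub, hint, -⟩ := id hu
  have hp0 : 0 < p := by linarith
  have hq0 : 0 < q := by linarith
  have : Fact (volume Ω < ⊤) := ⟨hΩb.measure_lt_top⟩
  obtain ⟨A, hA⟩ := hΩb.isCompact_closure.exists_bound_of_continuousOn ha
  obtain ⟨M, hM⟩ := hΩb.isCompact_closure.exists_bound_of_continuousOn huc
  have hf : ContinuousOn (fun x => lam * u x ^ (p - 1) + a x * u x ^ (q - 1)) (closure Ω) :=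
    (continuousOn_const.mul (huc.rpow_const fun _ _ => Or.inr (by linarith))).add
      (ha.mul (huc.rpow_const fun _ _ => Or.inr (by linarith)))
  obtain ⟨B, hB⟩ := hΩb.isCompact_closure.exists_bound_of_continuousOn hf
  let k : ℕ → ℝ := fun n => 1 / ((n : ℝ) + 1)
  have hk : ∀ n, 0 < k n := fun n => by positivity
  have hk0 : Tendsto k atTop (𝓝 0) := tendsto_one_div_add_atTop_nhds_zero_nat
  let H : ℕ → ℝ → ℝ := fun n s => s ^ 2 / (s + k n)
  let H' : ℕ → ℝ → ℝ := fun n s => 1 - k n ^ 2 / (s + k n) ^ 2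
  have hne : ∀ n s, 0 ≤ s → s + k n ≠ 0 := fun n s hs => by linarith [hk n]
  have hH : ∀ n s, 0 ≤ s → HasDerivAt (H n) (H' n s) s := fun n s hs => by
    have hs' := hne n s hs
    refine ((hasDerivAt_pow 2 s).div ((hasDerivAt_id s).add_const (k n)) hs').congr_deriv ?_
    simp only [H', id]
    field_simp
    push_cast
    ring
  have hH' : ∀ n, ContinuousOn (H' n) (Ici 0) := fun n =>
    continuousOn_const.sub (continuousOn_const.div (by fun_prop) fun s hs => by
      exact pow_ne_zero 2 (hne n s hs))
  have h0 : ∀ n, H n 0 = 0 := fun n => by simp [H]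
  have h0' : ∀ n, H' n 0 = 0 := fun n => by simp [H', (hk n).ne']
  have hHnn : ∀ n s, 0 ≤ s → 0 ≤ H n s := fun n s hs => by
    have := hk n
    positivity
  have hH'nn : ∀ n s, 0 ≤ s → 0 ≤ H' n s := fun n s hs => by
    have := hk n
    simp only [H', sub_nonneg]
    rw [div_le_one (by positivity)]
    gcongr
    linarith
  have hH'le : ∀ n s, 0 ≤ s → H' n s ≤ 1 := fun n s hs => by
    have := hk n
    simp only [H']
    linarith [show 0 ≤ k n ^ 2 / (s + k n) ^ 2 by positivity]
  have hHle : ∀ n s, 0 ≤ s → H n s ≤ s := fun n s hs => by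
    have := hk n
    simp only [H]
    rw [div_le_iff₀ (by positivity)]
    nlinarith
  have hHge : ∀ n s, 0 ≤ s → s - k n ≤ H n s := fun n s hs => by
    have := hk n
    simp only [H]
    rw [le_div_iff₀ (by positivity)]
    nlinarith
  let g : ℕ → EuclideanSpace ℝ (Fin N) → ℝ := fun n =>
    Ω.indicator fun x => H n (max (u x - k n) 0)
  have hgΩ : ∀ n, ∀ x ∈ Ω, g n x = H n (max (u x - k n) 0) := fun n x hx => indicator_of_mem hx _
  have hgreg := fun n => truncation_regularity hΩo hΩb huc hud hug hub (hH n) (hH' n) (h0 n)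
    (h0' n) (hk n)
  have hgcont : ∀ n, Continuous (g n) := fun n => (hgreg n).1.continuous
  have hgnn : ∀ n, ∀ x ∈ Ω, 0 ≤ g n x := fun n x hx => by
    rw [hgΩ n x hx]
    exact hHnn n _ (le_max_right _ _)
  have hgle : ∀ n, ∀ x ∈ Ω, g n x ≤ u x := fun n x hx => by
    rw [hgΩ n x hx]
    refine (hHle n _ (le_max_right _ _)).trans (max_le ?_ (hnn x hx))
    linarith [hk n]
  have hgM : ∀ n, ∀ x ∈ Ω, |g n x| ≤ M := fun n x hx => by
    rw [abs_of_nonneg (hgnn n x hx)]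
    exact (hgle n x hx).trans ((le_abs_self _).trans (hM x (subset_closure hx)))
  have hgt : ∀ x ∈ Ω, Tendsto (fun n => g n x) atTop (𝓝 (u x)) := fun x hx => by
    refine tendsto_of_tendsto_of_tendsto_of_le_of_le (g := fun n => u x - 2 * k n) ?_
      tendsto_const_nhds (fun n => ?_) fun n => hgle n x hx
    · simpa using (hk0.const_mul 2).const_sub (u x)
    · simp only
      rw [hgΩ n x hx]
      refine le_trans ?_ (hHge n _ (le_max_right _ _))
      linarith [le_max_left (u x - k n) 0]
  have hmem := ae_restrict_mem (μ := volume) hΩo.measurableSet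
  have habs : ∀ x ∈ Ω, |u x| = u x := fun x hx => abs_of_nonneg (hnn x hx)
  have t1 : Tendsto (fun n => ∫ x in Ω, |g n x| ^ p) atTop (𝓝 (∫ x in Ω, u x ^ p)) := by
    refine tendsto_integral_of_dominated_convergence (fun _ => M ^ p) (fun n => ?_)
      (integrable_const _) (fun n => ?_) ?_
    · exact ((hgcont n).abs.rpow_const fun _ => Or.inr hp0.le).aestronglyMeasurable
    · filter_upwards [hmem] with x hx
      rw [Real.norm_of_nonneg (by positivity)]
      exact Real.rpow_le_rpow (abs_nonneg _) (hgM n x hx) hp0.le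
    · filter_upwards [hmem] with x hx
      simpa only [habs x hx] using (hgt x hx).abs.rpow_const (Or.inr hp0.le)
  have t2 : Tendsto (fun n => ∫ x in Ω, a x * |g n x| ^ q) atTop
      (𝓝 (∫ x in Ω, a x * u x ^ q)) := by
    refine tendsto_integral_of_dominated_convergence (fun _ => A * M ^ q) (fun n => ?_)
      (integrable_const _) (fun n => ?_) ?_
    · exact ((ha.mono subset_closure).aestronglyMeasurable hΩo.measurableSet).mul
        ((hgcont n).abs.rpow_const fun _ => Or.inr hq0.le).aestronglyMeasurable
    · filter_upwards [hmem] with x hx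
      rw [norm_mul, Real.norm_of_nonneg (by positivity : 0 ≤ |g n x| ^ q)]
      have h1 := hA x (subset_closure hx)
      exact mul_le_mul h1 (Real.rpow_le_rpow (abs_nonneg _) (hgM n x hx) hq0.le) (by positivity)
        ((norm_nonneg _).trans h1)
    · filter_upwards [hmem] with x hx
      simpa only [habs x hx] using ((hgt x hx).abs.rpow_const (Or.inr hq0.le)).const_mul (a x)
  have t3 : Tendsto (fun n => ∫ x in Ω, (lam * u x ^ (p - 1) + a x * u x ^ (q - 1)) * g n x)
      atTop (𝓝 (∫ x in Ω, (lam * u x ^ (p - 1) + a x * u x ^ (q - 1)) * u x)) := by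
    refine tendsto_integral_of_dominated_convergence (fun _ => B * M) (fun n => ?_)
      (integrable_const _) (fun n => ?_) ?_
    · exact ((hf.mono subset_closure).aestronglyMeasurable hΩo.measurableSet).mul
        (hgcont n).aestronglyMeasurable
    · filter_upwards [hmem] with x hx
      have h1 := hB x (subset_closure hx)
      rw [norm_mul]
      exact mul_le_mul h1 (hgM n x hx) (norm_nonneg _) ((norm_nonneg _).trans h1)
    · filter_upwards [hmem] with x hx using (hgt x hx).const_mul _
  have hlim : (∫ x in Ω, (lam * u x ^ (p - 1) + a x * u x ^ (q - 1)) * u x) =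
      ∫ x in Ω, (lam * u x ^ p + a x * u x ^ q) := by
    refine setIntegral_congr_fun hΩo.measurableSet fun x hx => ?_
    have hr : ∀ r : ℝ, 1 < r → u x ^ (r - 1) * u x = u x ^ r := fun r hr => by
      rcases (hnn x hx).eq_or_lt with h | h
      · rw [← h, mul_zero, Real.zero_rpow (by linarith)]
      · rw [← Real.rpow_add_one h.ne', sub_add_cancel]
    rw [add_mul, mul_assoc, mul_assoc, hr p hp, hr q hq]
  rw [hlim] at t3
  refine le_of_tendsto_of_tendsto (t1.const_mul _) t3 ?_
  filter_upwards [t2.eventually (lt_mem_nhds hpos)] with n hn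
  refine (_root_.lambdaStar_mul_le hΩo hΩb hp0 hq0 ha (hgreg n).1 (hgreg n).2.1 (hgreg n).2.2.1
    hn).trans ?_
  have htest := hu.test_truncation hΩo hΩb hp hq ha (hH n) (hH' n) (h0 n) (h0' n) (hHnn n) (hk n)
  have hH'm : AEStronglyMeasurable (fun x => H' n (max (u x - k n) 0)) (volume.restrict Ω) := by
    refine ContinuousOn.aestronglyMeasurable ?_ hΩo.measurableSet
    refine (hH' n).comp ?_ fun y _ => mem_Ici.2 (le_max_right _ _)
    exact (((huc.mono subset_closure).sub continuousOn_const).sup continuousOn_const)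
  calc (∫ x in Ω, ‖gradient (g n) x‖ ^ p)
      ≤ ∫ x in Ω, H' n (max (u x - k n) 0) * ‖gradient u x‖ ^ p := by
        refine integral_mono_of_nonneg (.of_forall fun x => by positivity) ?_ ?_
        · refine Integrable.mono' hint (hH'm.mul hint.aestronglyMeasurable) (.of_forall fun x => ?_)
          have h1 := hH'nn n _ (le_max_right (u x - k n) 0)
          have h2 := hH'le n _ (le_max_right (u x - k n) 0)
          rw [Real.norm_of_nonneg (by positivity)]
          exact mul_le_of_le_one_left (by positivity) h2
        · filter_upwards [hmem] with x hx
          have h1 := hH'nn n _ (le_max_right (u x - k n) 0)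
          have h2 := hH'le n _ (le_max_right (u x - k n) 0)
          rw [(hgreg n).2.2.2 x hx, norm_smul, Real.norm_of_nonneg h1,
            Real.mul_rpow h1 (norm_nonneg _)]
          gcongr
          simpa using Real.rpow_le_rpow_of_exponent_ge' h1 h2 zero_le_one hp.le
    _ ≤ _ := htest
    _ = _ := setIntegral_congr_fun hΩo.measurableSet fun x hx => by
        simp only [hgΩ n x hx]

/-- Uniform `L^p` bound. -/
theorem exists_lp_bound {N : ℕ} {Ω : Set (EuclideanSpace ℝ (Fin N))}
    (hΩo : IsOpen Ω) (hΩb : Bornology.IsBounded Ω) {p q lam : ℝ} (hq : 1 < q) (hqp : q < p)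
    {a : EuclideanSpace ℝ (Fin N) → ℝ} (ha : ContinuousOn a (closure Ω))
    (hlam : lam < lambdaStar Ω p q a) :
    ∃ R : ℝ, 0 ≤ R ∧ ∀ u : EuclideanSpace ℝ (Fin N) → ℝ, DirichletSubsol Ω p q lam a u →
      (0 < ∫ x in Ω, a x * u x ^ q) → (∫ x in Ω, u x ^ p) ≤ R := by
  obtain ⟨A₀, hA₀⟩ := hΩb.isCompact_closure.exists_bound_of_continuousOn ha
  set A := max A₀ 0
  have hA : ∀ x ∈ closure Ω, ‖a x‖ ≤ A := fun x hx => (hA₀ x hx).trans (le_max_left _ _)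
  have hA0 : 0 ≤ A := le_max_right _ _
  have hfin : Fact (volume Ω < ⊤) := ⟨hΩb.measure_lt_top⟩
  set d := lambdaStar Ω p q a - lam with hd
  have hdpos : 0 < d := sub_pos.2 hlam
  obtain ⟨L, hL0, hL⟩ : ∃ L : ℝ, 0 < L ∧ A * L ^ (q - p) ≤ d / 2 := by
    have h1 := (tendsto_rpow_neg_atTop (sub_pos.2 hqp)).const_mul A
    rw [mul_zero] at h1
    obtain ⟨L, h2, h3⟩ := ((h1.eventually (gt_mem_nhds (half_pos hdpos))).and
      (eventually_gt_atTop 0)).exists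
    rw [neg_sub] at h2
    exact ⟨L, h3, h2.le⟩
  refine ⟨A * L ^ q * volume.real Ω / (d / 2), by positivity, fun u hu hpos => ?_⟩
  have h1 := hu.lambdaStar_mul_le hΩo hΩb (hq.trans hqp) hq ha hpos
  have hi : IntegrableOn (fun x => u x ^ p) Ω := integrableOn_of_continuousOn_closure hΩb
    (hu.1.rpow_const fun _ _ => Or.inr (by linarith))
  have h2 : (∫ x in Ω, (lam * u x ^ p + a x * u x ^ q)) ≤
      ∫ x in Ω, ((lam + d / 2) * u x ^ p + A * L ^ q) := by
    refine setIntegral_mono_on ?_ ((hi.const_mul _).add (integrable_const _)) hΩo.measurableSet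
      fun x hx => ?_
    · exact integrableOn_of_continuousOn_closure hΩb ((continuousOn_const.mul
        (hu.1.rpow_const fun _ _ => Or.inr (by linarith))).add
        (ha.mul (hu.1.rpow_const fun _ _ => Or.inr (by linarith))))
    · have hux := hu.2.2.2.1 x hx
      have h3 : u x ^ q ≤ L ^ q + L ^ (q - p) * u x ^ p := by
        rcases le_total (u x) L with h | h
        · have := Real.rpow_le_rpow hux h (by linarith : 0 ≤ q)
          have : 0 ≤ L ^ (q - p) * u x ^ p := by positivity
          linarith
        · have h4 : 0 < u x := hL0.trans_le h
          have h5 : u x ^ (q - p) ≤ L ^ (q - p) :=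
            Real.rpow_le_rpow_of_nonpos hL0 h (by linarith)
          calc u x ^ q = u x ^ (q - p) * u x ^ p := by
                rw [← Real.rpow_add h4, sub_add_cancel]
            _ ≤ L ^ (q - p) * u x ^ p := by gcongr
            _ ≤ _ := by linarith [show 0 ≤ L ^ q by positivity]
      have h4 : a x * u x ^ q ≤ A * (L ^ q + L ^ (q - p) * u x ^ p) :=
        mul_le_mul ((le_abs_self _).trans (hA x (subset_closure hx))) h3 (by positivity) hA0
      have h5 : A * L ^ (q - p) * u x ^ p ≤ d / 2 * u x ^ p := by gcongr
      linarith
  rw [integral_add (hi.const_mul _) (integrable_const _), integral_const_mul,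
    setIntegral_const, smul_eq_mul] at h2
  rw [le_div_iff₀ (by positivity)]
  have h3 := h1.trans h2
  have h4 : lambdaStar Ω p q a = lam + d := by rw [hd]; ring
  rw [h4] at h3
  linarith

theorem DirichletSubsol.level_decay {N : ℕ} {Ω : Set (EuclideanSpace ℝ (Fin N))}
    (hΩo : IsOpen Ω) (hΩb : Bornology.IsBounded Ω) {p q lam : ℝ} (hq : 1 < q) (hqp : q < p)
    {a u : EuclideanSpace ℝ (Fin N) → ℝ} (ha : ContinuousOn a (closure Ω))
    (hu : DirichletSubsol Ω p q lam a u) {A M θ C : ℝ} (hA : ∀ x ∈ Ω, |a x| ≤ A) (hA0 : 0 ≤ A)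
    (hM1 : 1 ≤ M) (hM : ∀ x ∈ Ω, u x ≤ M) (hθ : 1 < θ) (hC : 0 ≤ C)
    (hsob : ∀ g : EuclideanSpace ℝ (Fin N) → ℝ, ContDiff ℝ 1 g →
      HasCompactSupport g → tsupport g ⊆ Ω → ∀ t : ℝ, 0 < t →
      t ^ θ * volume.real {x ∈ Ω | t ≤ g x} ≤ C * (∫ x in Ω, ‖gradient g x‖) ^ θ)
    {k h : ℝ} (hk : 0 < k) (hkh : k < h) :
    ((h - k) ^ 2) ^ θ * volume.real {x ∈ Ω | h ≤ u x} ≤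
      C * (2 * (|lam| + A + 1) * M ^ 2 * volume.real {x ∈ Ω | k ≤ u x}) ^ θ := by
  obtain ⟨huc, hud, hug, hnn, hub, hint, -⟩ := id hu
  have hp : 1 < p := hq.trans hqp
  have hp0 : 0 < p := by linarith
  have hM0 : 0 < M := by linarith
  have hfin : Fact (volume Ω < ⊤) := ⟨hΩb.measure_lt_top⟩
  have hmem := ae_restrict_mem (μ := volume) hΩo.measurableSet
  set w : EuclideanSpace ℝ (Fin N) → ℝ := fun x => max (u x - k) 0
  have hw0 : ∀ x, 0 ≤ w x := fun x => le_max_right _ _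
  have hwM : ∀ x ∈ Ω, w x ≤ M := fun x hx => max_le (by linarith [hM x hx]) hM0.le
  set E := {x ∈ Ω | k ≤ u x}
  have hEm : MeasurableSet E := by
    have h1 : IsClosed (closure Ω ∩ u ⁻¹' Ici k) :=
      huc.preimage_isClosed_of_isClosed isClosed_closure isClosed_Ici
    have : E = Ω ∩ (closure Ω ∩ u ⁻¹' Ici k) := by
      ext x
      exact ⟨fun hx => ⟨hx.1, subset_closure hx.1, hx.2⟩, fun hx => ⟨hx.1, hx.2.2⟩⟩
    rw [this]
    exact hΩo.measurableSet.inter h1.measurableSet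
  have hEΩ : E ⊆ Ω := fun x hx => hx.1
  have hwE : ∀ x ∈ Ω, x ∉ E → w x = 0 := fun x hx hxE => by
    refine max_eq_right ?_
    by_contra h
    exact hxE ⟨hx, by linarith⟩
  have hindint : ∀ c : ℝ, (∫ x in Ω, E.indicator (fun _ => c) x) = c * volume.real E := fun c => by
    rw [setIntegral_indicator hEm, inter_eq_self_of_subset_right hEΩ, setIntegral_const,
      smul_eq_mul, mul_comm]
  have hindI : ∀ c : ℝ, IntegrableOn (E.indicator fun _ => c) Ω := fun c =>
    (integrable_const c).indicator hEm
  -- energy estimate with the test function `w ^ (p + 1)`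
  have hderiv : ∀ s : ℝ, 0 ≤ s → HasDerivAt (fun s => s ^ (p + 1)) ((p + 1) * s ^ p) s := by
    intro s _
    have hp1 : s ≠ 0 ∨ 1 ≤ p + 1 := Or.inr (by linarith)
    simpa using Real.hasDerivAt_rpow_const hp1
  have htest := hu.test_truncation hΩo hΩb hp hq ha (H := fun s => s ^ (p + 1))
    (H' := fun s => (p + 1) * s ^ p)
    hderiv
    (continuousOn_const.mul (continuousOn_id.rpow_const fun _ _ => Or.inr hp0.le))
    (Real.zero_rpow (by linarith)) (by simp [hp0.ne']) (fun s hs => by positivity) hk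
  have hrhs : (∫ x in Ω, (lam * u x ^ (p - 1) + a x * u x ^ (q - 1)) * w x ^ (p + 1)) ≤
      (|lam| + A) * (M ^ (p - 1) * M ^ (p + 1)) * volume.real E := by
    rw [← hindint]
    refine setIntegral_mono_on ?_ (hindI _) hΩo.measurableSet fun x hx => ?_
    · refine integrableOn_of_continuousOn_closure hΩb (((continuousOn_const.mul
        (huc.rpow_const fun _ _ => Or.inr (by linarith))).add
        (ha.mul (huc.rpow_const fun _ _ => Or.inr (by linarith)))).mul ?_)
      exact ((huc.sub continuousOn_const).sup continuousOn_const).rpow_const fun _ _ =>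
        Or.inr (by linarith)
    · by_cases hxE : x ∈ E
      · rw [indicator_of_mem hxE]
        have h0 := hnn x hx
        have h1 : u x ^ (p - 1) ≤ M ^ (p - 1) :=
          Real.rpow_le_rpow h0 (hM x hx) (by linarith)
        have h2 : u x ^ (q - 1) ≤ M ^ (p - 1) :=
          (Real.rpow_le_rpow h0 (hM x hx) (by linarith)).trans
            (Real.rpow_le_rpow_of_exponent_le hM1 (by linarith))
        have h3 : lam * u x ^ (p - 1) ≤ |lam| * M ^ (p - 1) :=
          mul_le_mul (le_abs_self _) h1 (by positivity) (abs_nonneg _)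
        have h4 : a x * u x ^ (q - 1) ≤ A * M ^ (p - 1) :=
          mul_le_mul ((le_abs_self _).trans (hA x hx)) h2 (by positivity) hA0
        have h5 : w x ^ (p + 1) ≤ M ^ (p + 1) :=
          Real.rpow_le_rpow (hw0 x) (hwM x hx) (by linarith)
        rw [← mul_assoc]
        refine mul_le_mul (by linarith) h5 (Real.rpow_nonneg (hw0 x) _) (by positivity)
      · rw [indicator_of_notMem hxE, hwE x hx hxE, Real.zero_rpow (by linarith), mul_zero]
  -- the function `w ^ 2`
  obtain ⟨hg, hc, hs, hgr⟩ := truncation_regularity hΩo hΩb huc hud hug hub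
    (H := fun s => s ^ 2) (H' := fun s => 2 * s) (fun s _ => by simpa using hasDerivAt_pow 2 s)
    (by fun_prop) (by simp) (by simp) hk
  set g := Ω.indicator fun x => w x ^ 2
  have hwp : IntegrableOn (fun x => w x ^ p * ‖gradient u x‖ ^ p) Ω := by
    refine Integrable.mono' (hint.const_mul (M ^ p)) ?_ ?_
    · refine AEStronglyMeasurable.mul ?_ hint.aestronglyMeasurable
      refine ContinuousOn.aestronglyMeasurable ?_ hΩo.measurableSet
      exact (((huc.mono subset_closure).sub continuousOn_const).sup continuousOn_const).rpow_const
        fun _ _ => Or.inr hp0.le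
    · filter_upwards [hmem] with x hx
      have h1 := Real.rpow_le_rpow (hw0 x) (hwM x hx) hp0.le
      have h2 := Real.rpow_nonneg (hw0 x) p
      rw [Real.norm_of_nonneg (by positivity)]
      gcongr
  have hwpint : (∫ x in Ω, w x ^ p * ‖gradient u x‖ ^ p) ≤
      (|lam| + A) * (M ^ (p - 1) * M ^ (p + 1)) * volume.real E := by
    refine le_trans ?_ (htest.trans hrhs)
    have : (∫ x in Ω, (p + 1) * w x ^ p * ‖gradient u x‖ ^ p) =
        (p + 1) * ∫ x in Ω, w x ^ p * ‖gradient u x‖ ^ p := by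
      rw [← integral_const_mul]
      simp_rw [mul_assoc]
    rw [this]
    refine le_mul_of_one_le_left (integral_nonneg fun x => ?_) (by linarith)
    have h2 := Real.rpow_nonneg (hw0 x) p
    positivity
  have hyoung : ∀ y : ℝ, 0 ≤ y → y ≤ (M ^ 2) ^ (1 - p) * y ^ p + M ^ 2 := fun y hy => by
    rcases le_total y (M ^ 2) with h | h
    · linarith [show 0 ≤ (M ^ 2) ^ (1 - p) * y ^ p by positivity]
    · have hy0 : 0 < y := lt_of_lt_of_le (by positivity) h
      have h1 : y ^ (1 - p) ≤ (M ^ 2) ^ (1 - p) :=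
        Real.rpow_le_rpow_of_nonpos (by positivity) h (by linarith)
      calc y = y ^ (1 - p) * y ^ p := by
            rw [← Real.rpow_add hy0, sub_add_cancel, Real.rpow_one]
        _ ≤ (M ^ 2) ^ (1 - p) * y ^ p := by gcongr
        _ ≤ _ := by linarith [sq_nonneg M]
  have hgint : (∫ x in Ω, ‖gradient g x‖) ≤
      2 * (|lam| + A + 1) * M ^ 2 * volume.real E := by
    calc (∫ x in Ω, ‖gradient g x‖)
        ≤ ∫ x in Ω, (2 * (M ^ 2) ^ (1 - p) * (w x ^ p * ‖gradient u x‖ ^ p) +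
            E.indicator (fun _ => 2 * M ^ 2) x) := by
          refine integral_mono_of_nonneg (.of_forall fun x => norm_nonneg _)
            ((hwp.const_mul _).add (hindI _)) ?_
          filter_upwards [hmem] with x hx
          rw [hgr x hx, norm_smul, Real.norm_of_nonneg (by linarith [hw0 x] : 0 ≤ 2 * w x)]
          by_cases hxE : x ∈ E
          · rw [indicator_of_mem hxE, ← Real.mul_rpow (hw0 x) (norm_nonneg _)]
            linarith [hyoung _ (mul_nonneg (hw0 x) (norm_nonneg (gradient u x)))]
          · rw [indicator_of_notMem hxE, hwE x hx hxE]
            simp [hp0.ne']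
      _ = 2 * (M ^ 2) ^ (1 - p) * (∫ x in Ω, w x ^ p * ‖gradient u x‖ ^ p) +
            2 * M ^ 2 * volume.real E := by
          rw [integral_add (hwp.const_mul _) (hindI _), hindint, integral_const_mul]
      _ ≤ 2 * (M ^ 2) ^ (1 - p) * ((|lam| + A) * (M ^ (p - 1) * M ^ (p + 1)) * volume.real E) +
            2 * M ^ 2 * volume.real E := by gcongr
      _ = 2 * ((M ^ 2) ^ (1 - p) * (M ^ (p - 1) * M ^ (p + 1))) * (|lam| + A) * volume.real E +
            2 * M ^ 2 * volume.real E := by ring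
      _ = 2 * (|lam| + A + 1) * M ^ 2 * volume.real E := by
          have : (M ^ 2) ^ (1 - p) * (M ^ (p - 1) * M ^ (p + 1)) = M ^ 2 := by
            rw [← Real.rpow_natCast, ← Real.rpow_mul hM0.le, ← Real.rpow_add hM0,
              ← Real.rpow_add hM0]
            congr 1
            push_cast
            ring
          rw [this]
          ring
  have hsub : {x ∈ Ω | h ≤ u x} ⊆ {x ∈ Ω | (h - k) ^ 2 ≤ g x} := fun x hx => by
    refine ⟨hx.1, ?_⟩
    have hgx : g x = w x ^ 2 := indicator_of_mem hx.1 _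
    rw [hgx]
    have h1 : h - k ≤ w x := le_trans (by linarith [hx.2]) (le_max_left _ _)
    exact pow_le_pow_left₀ (by linarith) h1 2
  have hpos : 0 < (h - k) ^ 2 := pow_pos (by linarith) 2
  calc ((h - k) ^ 2) ^ θ * volume.real {x ∈ Ω | h ≤ u x}
      ≤ ((h - k) ^ 2) ^ θ * volume.real {x ∈ Ω | (h - k) ^ 2 ≤ g x} := by
        gcongr
        · exact ((measure_mono fun x hx => hx.1).trans_lt hΩb.measure_lt_top).ne
    _ ≤ C * (∫ x in Ω, ‖gradient g x‖) ^ θ := hsob g hg hc hs _ hpos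
    _ ≤ _ := mul_le_mul_of_nonneg_left (Real.rpow_le_rpow
        (integral_nonneg fun _ => norm_nonneg _) hgint (by linarith)) hC

/-- The fast geometric convergence lemma of De Giorgi. -/
theorem exists_threshold_tendsto_zero {B D θ : ℝ} (hB : 0 ≤ B) (hD : 1 < D) (hθ : 1 < θ) :
    ∃ η : ℝ, 0 < η ∧ ∀ x : ℕ → ℝ, (∀ n, 0 ≤ x n) → (∀ n, x (n + 1) ≤ B * D ^ n * x n ^ θ) →
      x 0 ≤ η → Tendsto x atTop (𝓝 0) := by
  have hD0 : 0 < D := by linarith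
  have hθ1 : 0 < θ - 1 := by linarith
  set ρ := D ^ (-1 / (θ - 1)) with hρ
  have hρ0 : 0 < ρ := by positivity
  have hρ1 : ρ < 1 := Real.rpow_lt_one_of_one_lt_of_neg hD
    (div_neg_of_neg_of_pos (by norm_num) hθ1)
  have hρD : ρ ^ θ = ρ / D := by
    have h1 : ρ ^ (θ - 1) = D⁻¹ := by
      rw [hρ, ← Real.rpow_mul hD0.le, div_mul_cancel₀ _ hθ1.ne', Real.rpow_neg_one]
    rw [div_eq_mul_inv, ← h1, mul_comm, ← Real.rpow_add_one hρ0.ne', sub_add_cancel]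
  refine ⟨(ρ / (B + 1)) ^ (1 / (θ - 1)), by positivity, fun x hx0 hx hη => ?_⟩
  have hsmall : B * x 0 ^ (θ - 1) ≤ ρ := by
    have h1 : x 0 ^ (θ - 1) ≤ ρ / (B + 1) := by
      refine (Real.rpow_le_rpow (hx0 0) hη hθ1.le).trans ?_
      rw [← Real.rpow_mul (by positivity), one_div_mul_cancel hθ1.ne', Real.rpow_one]
    calc B * x 0 ^ (θ - 1) ≤ (B + 1) * (ρ / (B + 1)) := by
          refine mul_le_mul (by linarith) h1 (Real.rpow_nonneg (hx0 0) _) (by linarith)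
      _ = ρ := mul_div_cancel₀ _ (by linarith)
  have hx0θ : x 0 ^ θ = x 0 ^ (θ - 1) * x 0 := by
    rcases (hx0 0).eq_or_lt with h | h
    · rw [← h, mul_zero, Real.zero_rpow (by linarith)]
    · rw [← Real.rpow_add_one h.ne', sub_add_cancel]
  have hdecay : ∀ n, x n ≤ x 0 * ρ ^ n := by
    intro n
    induction n with
    | zero => simp
    | succ n ih =>
      have h1 : (ρ ^ n) ^ θ = (ρ / D) ^ n := by
        rw [← hρD, ← Real.rpow_natCast, ← Real.rpow_natCast, ← Real.rpow_mul hρ0.le,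
          ← Real.rpow_mul hρ0.le, mul_comm]
      calc x (n + 1) ≤ B * D ^ n * x n ^ θ := hx n
        _ ≤ B * D ^ n * (x 0 * ρ ^ n) ^ θ := by
          gcongr
          exact hx0 n
        _ = (B * x 0 ^ (θ - 1)) * (x 0 * ρ ^ n) := by
          rw [Real.mul_rpow (hx0 0) (by positivity), h1, hx0θ, div_pow]
          field_simp
        _ ≤ ρ * (x 0 * ρ ^ n) := mul_le_mul_of_nonneg_right hsmall
          (mul_nonneg (hx0 0) (by positivity))
        _ = x 0 * ρ ^ (n + 1) := by ring
  refine squeeze_zero hx0 hdecay ?_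
  simpa using (tendsto_pow_atTop_nhds_zero_of_lt_one hρ0.le hρ1).const_mul (x 0)

/-- Uniform a priori bound: for `λ < λ*(a,q)` there is `K > 0` bounding every Dirichlet
weak subsolution `u` of `(P_λ)` with `∫_Ω a u^q > 0`. -/
theorem uniform_bound_for_subsolutions
    {N : ℕ} (hN : 1 ≤ N) (Ω : Set (EuclideanSpace ℝ (Fin N)))
    (hΩne : Ω.Nonempty) (hΩo : IsOpen Ω) (hΩb : Bornology.IsBounded Ω)
    (p q : ℝ) (h1q : 1 < q) (hqp : q < p)
    (a : EuclideanSpace ℝ (Fin N) → ℝ) (ha : ContinuousOn a (closure Ω))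
    (haplus : ∃ x ∈ Ω, 0 < a x) (haminus : ∃ x ∈ Ω, a x < 0)
    (lam : ℝ) (hlam : lam < lambdaStar Ω p q a) :
    ∃ K : ℝ, 0 < K ∧ ∀ u : EuclideanSpace ℝ (Fin N) → ℝ,
      DirichletSubsol Ω p q lam a u → (0 < ∫ x in Ω, a x * u x ^ q) →
      ∀ x ∈ Ω, u x ≤ K := by
  obtain ⟨θ, C, hθ, hC, hsob⟩ := weak_type_sobolev hN hΩb
  obtain ⟨R, hR0, hR⟩ := exists_lp_bound hΩo hΩb h1q hqp ha hlam
  obtain ⟨A₀, hA₀⟩ := hΩb.isCompact_closure.exists_bound_of_continuousOn ha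
  set A := max A₀ 0
  have hA : ∀ x ∈ Ω, |a x| ≤ A := fun x hx => (hA₀ x (subset_closure hx)).trans (le_max_left _ _)
  have hA0 : 0 ≤ A := le_max_right _ _
  have hp0 : 0 < p := by linarith
  set c := 2 * (|lam| + A + 1) with hc
  have hc0 : 0 < c := by positivity
  obtain ⟨η, hη, hiter⟩ := exists_threshold_tendsto_zero (B := C * (64 * c) ^ θ)
    (D := 4 ^ θ) (θ := θ) (by positivity) (Real.one_lt_rpow (by norm_num) (by linarith)) hθ
  refine ⟨max 1 ((2 ^ p * R / η) ^ (1 / p)), lt_of_lt_of_le one_pos (le_max_left _ _),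
    fun u hu hpos => ?_⟩
  by_contra! hcon
  obtain ⟨y, hy, hKy⟩ := hcon
  obtain ⟨x₀, hx₀, hmax⟩ := hΩb.isCompact_closure.exists_isMaxOn hΩne.closure hu.1
  set M := u x₀ with hMdef
  have hKM := hKy.trans_le (hmax (subset_closure hy))
  have hM1 : 1 ≤ M := (le_max_left _ _).trans hKM.le
  have hM0 : 0 < M := by linarith
  have hM : ∀ x ∈ Ω, u x ≤ M := fun x hx => hmax (subset_closure hx)
  have hx₀Ω : x₀ ∈ Ω := by
    by_contra h
    exact hM0.ne' (hu.2.2.2.2.1 x₀ ⟨hx₀, by rwa [hΩo.interior_eq]⟩)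
  have hfin : ∀ s ⊆ Ω, volume s ≠ ⊤ := fun s hs =>
    ((measure_mono hs).trans_lt hΩb.measure_lt_top).ne
  let k : ℕ → ℝ := fun n => M * (3 / 4 - (1 / 2) ^ n / 4)
  have hpow : ∀ n : ℕ, 0 < (1 / 2 : ℝ) ^ n ∧ (1 / 2 : ℝ) ^ n ≤ 1 := fun n =>
    ⟨by positivity, pow_le_one₀ (by norm_num) (by norm_num)⟩
  have hlim := hiter (fun n => volume.real {x ∈ Ω | k n ≤ u x}) (fun n => measureReal_nonneg)
    (fun n => ?_) ?_
  · have hopen : IsOpen (Ω ∩ u ⁻¹' Ioi (3 / 4 * M)) :=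
      (hu.1.mono subset_closure).isOpen_inter_preimage hΩo isOpen_Ioi
    have h1 : 0 < volume.real (Ω ∩ u ⁻¹' Ioi (3 / 4 * M)) := by
      refine ENNReal.toReal_pos (hopen.measure_pos volume ⟨x₀, hx₀Ω, ?_⟩).ne'
        (hfin _ inter_subset_left)
      simp only [mem_preimage, mem_Ioi]
      linarith
    refine h1.not_ge (ge_of_tendsto' hlim fun n => ?_)
    refine measureReal_mono (fun x hx => ⟨hx.1, ?_⟩) (hfin _ fun x hx => hx.1)
    have h2 : 3 / 4 * M < u x := hx.2
    have h3 := mul_pos hM0 (hpow n).1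
    simp only [k]
    linarith
  · have hk : 0 < k n := mul_pos hM0 (by linarith [(hpow n).2])
    have hdiff : k (n + 1) - k n = M * (1 / 2) ^ n / 8 := by
      simp only [k, pow_succ]
      ring
    have h1 := hu.level_decay hΩo hΩb h1q hqp ha hA hA0 hM1 hM hθ hC hsob hk
      (h := k (n + 1)) (sub_pos.1 (by rw [hdiff]; have := (hpow n).1; positivity))
    rw [hdiff, ← hc] at h1
    have hv := measureReal_nonneg (μ := volume) (s := {x ∈ Ω | k n ≤ u x})
    set v := volume.real {x ∈ Ω | k n ≤ u x}
    set t := (M * (1 / 2) ^ n / 8) ^ 2 with ht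
    have ht0 : 0 < t := by positivity
    have h2 : c * M ^ 2 * v = t * (64 * c * 4 ^ n * v) := by
      have h3 : ((1 / 2 : ℝ) ^ n) ^ 2 * 4 ^ n = 1 := by
        rw [← pow_mul, mul_comm n, pow_mul, ← mul_pow]
        norm_num
      calc c * M ^ 2 * v = c * M ^ 2 * v * (((1 / 2 : ℝ) ^ n) ^ 2 * 4 ^ n) := by
            rw [h3, mul_one]
        _ = _ := by rw [ht]; ring
    have h4 : ((4 : ℝ) ^ n) ^ θ = (4 ^ θ) ^ n := by
      rw [← Real.rpow_natCast, ← Real.rpow_natCast, ← Real.rpow_mul (by norm_num),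
        ← Real.rpow_mul (by norm_num), mul_comm]
    rw [h2, Real.mul_rpow ht0.le (by positivity), mul_left_comm C] at h1
    have h5 := le_of_mul_le_mul_left h1 (by positivity)
    refine h5.trans_eq ?_
    rw [Real.mul_rpow (by positivity) hv, Real.mul_rpow (by positivity) (by positivity), h4]
    ring
  · have hk0 : k 0 = M / 2 := by
      simp only [k]
      ring
    have hi : IntegrableOn (fun x => u x ^ p) Ω := integrableOn_of_continuousOn_closure hΩb
      (hu.1.rpow_const fun _ _ => Or.inr hp0.le)
    have h1 : (M / 2) ^ p * volume.real {x ∈ Ω | k 0 ≤ u x} ≤ R := by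
      refine le_trans ?_ (hR u hu hpos)
      refine le_trans ?_ (mul_meas_ge_le_integral_of_nonneg (f := fun x => u x ^ p) ?_ hi
        ((M / 2) ^ p))
      · refine mul_le_mul_of_nonneg_left ?_ (by positivity)
        rw [measureReal_restrict_apply' hΩo.measurableSet]
        refine measureReal_mono (fun x hx => ⟨?_, hx.1⟩) (hfin _ inter_subset_right)
        have h2 := hx.2
        rw [hk0] at h2
        exact Real.rpow_le_rpow (by positivity) h2 hp0.le
      · filter_upwards [ae_restrict_mem hΩo.measurableSet] with x hx
        exact Real.rpow_nonneg (hu.2.2.2.1 x hx) _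
    have h2 : 2 ^ p * R / η < M ^ p := by
      have h3 := Real.rpow_lt_rpow (by positivity) ((le_max_right _ _).trans_lt hKM) hp0
      rwa [← Real.rpow_mul (by positivity), one_div_mul_cancel hp0.ne', Real.rpow_one] at h3
    rw [div_lt_iff₀ hη] at h2
    rw [Real.div_rpow hM0.le (by norm_num), div_mul_eq_mul_div, div_le_iff₀ (by positivity)] at h1
    exact le_of_mul_le_mul_left (by linarith) (by positivity : 0 < M ^ p)
end
end

section
/- Suppose λ < λ*(a,q). Then there exists a constant C > 0 such that ∫_Ω (‖∇φ‖^p − λ|φ|^p) ≥ C ∫_Ω ‖∇φ‖^p for every smooth compactly supported function φ : ℝ^N → ℝ with support contained in Ω satisfying ∫_Ω a|φ|^q ≥ 0. -/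
open MeasureTheory RealInnerProductSpace

noncomputable section

namespace IsTestFun

variable {N : ℕ} {Ω : Set (EuclideanSpace ℝ (Fin N))} {φ : EuclideanSpace ℝ (Fin N) → ℝ}

lemma const_smul (hφ : IsTestFun Ω φ) (c : ℝ) : IsTestFun Ω (c • φ) := by
  have hsub : tsupport (c • φ) ⊆ tsupport φ :=
    closure_mono (Function.support_const_smul_subset c φ)
  exact ⟨hφ.1.const_smul c, hφ.2.1.mono' ((Function.support_const_smul_subset c φ).trans
    (subset_tsupport φ)), hsub.trans hφ.2.2⟩

lemma integrable_abs_rpow (hφ : IsTestFun Ω φ) {p : ℝ} (hp : 0 < p) :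
    Integrable (fun x => |φ x| ^ p) :=
  (hφ.1.continuous.abs.rpow_const fun _ => Or.inr hp.le).integrable_of_hasCompactSupport
    (hφ.2.1.comp_left (g := fun t : ℝ => |t| ^ p) (by simp [Real.zero_rpow hp.ne']))

lemma integrable_norm_fderiv_rpow (hφ : IsTestFun Ω φ) {p : ℝ} (hp : 0 < p) :
    Integrable (fun x => ‖fderiv ℝ φ x‖ ^ p) :=
  ((hφ.1.continuous_fderiv (by simp)).norm.rpow_const
    fun _ => Or.inr hp.le).integrable_of_hasCompactSupport
    ((hφ.2.1.fderiv ℝ).comp_left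
      (g := fun T : EuclideanSpace ℝ (Fin N) →L[ℝ] ℝ => ‖T‖ ^ p) (by simp [Real.zero_rpow hp.ne']))

end IsTestFun

lemma norm_gradient_eq_norm_fderiv {F : Type*} [NormedAddCommGroup F] [InnerProductSpace ℝ F]
    [CompleteSpace F] (f : F → ℝ) (x : F) : ‖gradient f x‖ = ‖fderiv ℝ f x‖ := by
  simp [gradient]

/-- The infimum defining `lambdaStar` gives a Poincaré-type inequality, by homogeneity. -/
lemma lambdaStar_mul_integral_le {N : ℕ} {Ω : Set (EuclideanSpace ℝ (Fin N))} {p q : ℝ}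
    (hp : 0 < p) {a φ : EuclideanSpace ℝ (Fin N) → ℝ} (hφ : IsTestFun Ω φ)
    (hA : 0 ≤ ∫ x in Ω, a x * |φ x| ^ q) :
    lambdaStar Ω p q a * (∫ x in Ω, |φ x| ^ p) ≤ ∫ x in Ω, ‖gradient φ x‖ ^ p := by
  have hM : 0 ≤ ∫ x in Ω, |φ x| ^ p := integral_nonneg fun x => by positivity
  have hG : 0 ≤ ∫ x in Ω, ‖gradient φ x‖ ^ p := integral_nonneg fun x => by positivity
  rcases hM.eq_or_lt with hM0 | hM
  · rwa [← hM0, mul_zero]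
  set M := ∫ x in Ω, |φ x| ^ p with hMdef
  obtain ⟨c, hc, hcp⟩ : ∃ c : ℝ, 0 < c ∧ c ^ p = M⁻¹ :=
    ⟨M⁻¹ ^ p⁻¹, by positivity, Real.rpow_inv_rpow (by positivity) hp.ne'⟩
  have habs (r : ℝ) (x) : |(c • φ) x| ^ r = c ^ r * |φ x| ^ r := by
    rw [Pi.smul_apply, smul_eq_mul, abs_mul, abs_of_pos hc, Real.mul_rpow hc.le (abs_nonneg _)]
  have hgrad (x) : ‖gradient (c • φ) x‖ ^ p = c ^ p * ‖gradient φ x‖ ^ p := by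
    have hd : DifferentiableAt ℝ φ x := (hφ.1.differentiable (by simp)) x
    rw [norm_gradient_eq_norm_fderiv, norm_gradient_eq_norm_fderiv, fderiv_const_smul hd,
      norm_smul, Real.norm_of_nonneg hc.le, Real.mul_rpow hc.le (norm_nonneg _)]
  have hle : lambdaStar Ω p q a ≤ ∫ x in Ω, ‖gradient (c • φ) x‖ ^ p := by
    refine csInf_le ⟨0, ?_⟩ ⟨c • φ, hφ.const_smul c, ?_, ?_, rfl⟩
    · rintro E ⟨ψ, -, -, -, rfl⟩
      exact integral_nonneg fun x => by positivity
    · simp_rw [habs]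
      rw [integral_const_mul, hcp, ← hMdef, inv_mul_cancel₀ hM.ne']
    · simp_rw [habs, mul_left_comm _ (c ^ q)]
      rw [integral_const_mul]
      positivity
  simp_rw [hgrad] at hle
  rw [integral_const_mul, hcp, inv_mul_eq_div, le_div_iff₀ hM] at hle
  exact hle

/-- Coercivity of `E_λ` on `{∫_Ω a|φ|^q ≥ 0}` for `λ < λ*(a,q)`. -/
theorem energy_coercive_on_A_plus
    {N : ℕ} (hN : 1 ≤ N) (Ω : Set (EuclideanSpace ℝ (Fin N)))
    (hΩne : Ω.Nonempty) (hΩo : IsOpen Ω) (hΩb : Bornology.IsBounded Ω)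
    (p q : ℝ) (h1q : 1 < q) (hqp : q < p)
    (a : EuclideanSpace ℝ (Fin N) → ℝ) (ha : ContinuousOn a (closure Ω))
    (haplus : ∃ x ∈ Ω, 0 < a x) (haminus : ∃ x ∈ Ω, a x < 0)
    (lam : ℝ) (hlam : lam < lambdaStar Ω p q a) :
    ∃ C : ℝ, 0 < C ∧ ∀ φ : EuclideanSpace ℝ (Fin N) → ℝ, IsTestFun Ω φ →
      (0 ≤ ∫ x in Ω, a x * |φ x| ^ q) →
      C * (∫ x in Ω, ‖gradient φ x‖ ^ p)
        ≤ ∫ x in Ω, (‖gradient φ x‖ ^ p - lam * |φ x| ^ p) := by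
  have hp : 0 < p := by linarith
  have hsub {φ : EuclideanSpace ℝ (Fin N) → ℝ} (hφ : IsTestFun Ω φ) :
      ∫ x in Ω, (‖gradient φ x‖ ^ p - lam * |φ x| ^ p)
        = (∫ x in Ω, ‖gradient φ x‖ ^ p) - lam * ∫ x in Ω, |φ x| ^ p := by
    rw [integral_sub, integral_const_mul]
    · simp_rw [norm_gradient_eq_norm_fderiv]
      exact (hφ.integrable_norm_fderiv_rpow hp).integrableOn
    · exact ((hφ.integrable_abs_rpow hp).const_mul lam).integrableOn
  rcases le_or_gt lam 0 with h0 | h0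
  · refine ⟨1, one_pos, fun φ hφ _ => ?_⟩
    have hM : 0 ≤ ∫ x in Ω, |φ x| ^ p := integral_nonneg fun x => by positivity
    rw [hsub hφ]
    linarith [mul_nonpos_of_nonpos_of_nonneg h0 hM]
  · have hL : 0 < lambdaStar Ω p q a := h0.trans hlam
    refine ⟨1 - lam / lambdaStar Ω p q a, sub_pos.2 ((div_lt_one hL).2 hlam), fun φ hφ hA => ?_⟩
    have hkey := mul_le_mul_of_nonneg_left (lambdaStar_mul_integral_le hp hφ hA)
      (div_pos h0 hL).le
    rw [← mul_assoc, div_mul_cancel₀ _ hL.ne'] at hkey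
    rw [hsub hφ]
    linarith
end
end

section
/- Let N ≥ 1 be an integer and let p, q be real numbers with 1 < q ≤ p. Then for all vectors x, y ∈ ℝ^N with x ≠ 0 and all real numbers s > 0 and t ≥ 0, one has ‖x‖^{p−2} · ( q·(t/s)^{q−1}·⟨x,y⟩ − (q−1)·(t/s)^q·‖x‖² ) ≤ ‖x‖^{p−q} · ‖y‖^q. -/
open RealInnerProductSpace

/-- Young's inequality in tangent-line form: the convex function `b ↦ b ^ q` lies above its
tangent line at `a`. -/
theorem rpow_tangent_line_le {a b q : ℝ} (ha : 0 ≤ a) (hb : 0 ≤ b) (hq : 1 < q) :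
    q * a ^ (q - 1) * b - (q - 1) * a ^ q ≤ b ^ q := by
  have hq0 : 0 < q := by linarith
  have h := Real.geom_mean_le_arith_mean2_weighted (w₁ := (q - 1) / q) (w₂ := 1 / q)
    (div_nonneg (by linarith) hq0.le) (by positivity)
    (Real.rpow_nonneg ha q) (Real.rpow_nonneg hb q) (by field_simp; ring)
  rw [← Real.rpow_mul ha, ← Real.rpow_mul hb, mul_div_cancel₀ _ hq0.ne',
    mul_one_div_cancel hq0.ne', Real.rpow_one] at h
  have h' := mul_le_mul_of_nonneg_left h hq0.le
  have e : q * ((q - 1) / q * a ^ q + 1 / q * b ^ q) = (q - 1) * a ^ q + b ^ q := by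
    field_simp
  linarith

/-- Pointwise form of the generalized Picone inequality: for `1 < q ≤ p`, `x ≠ 0`,
`s > 0`, `t ≥ 0`,
`‖x‖^{p-2} (q (t/s)^{q-1} ⟪x,y⟫ - (q-1)(t/s)^q ‖x‖²) ≤ ‖x‖^{p-q} ‖y‖^q`. -/
theorem pointwise_generalized_picone
    {N : ℕ} (hN : 1 ≤ N) (p q : ℝ) (h1q : 1 < q) (hqp : q ≤ p)
    (x y : EuclideanSpace ℝ (Fin N)) (hx : x ≠ 0)
    (s t : ℝ) (hs : 0 < s) (ht : 0 ≤ t) :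
    ‖x‖ ^ (p - 2) *
        (q * (t / s) ^ (q - 1) * ⟪x, y⟫ - (q - 1) * (t / s) ^ q * ‖x‖ ^ (2 : ℝ))
      ≤ ‖x‖ ^ (p - q) * ‖y‖ ^ q := by
  have hX : 0 < ‖x‖ := norm_pos_iff.mpr hx
  have hr : 0 ≤ t / s := div_nonneg ht hs.le
  have hpow : ‖x‖ ^ (p - 2) = ‖x‖ ^ (p - q) * ‖x‖ ^ (q - 2) := by
    rw [← Real.rpow_add hX]; ring_nf
  have hpow_one : ‖x‖ ^ (q - 1) = ‖x‖ ^ (q - 2) * ‖x‖ := by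
    rw [← Real.rpow_add_one hX.ne']; ring_nf
  have hpow_two : ‖x‖ ^ q = ‖x‖ ^ (q - 2) * ‖x‖ ^ (2 : ℝ) := by
    rw [← Real.rpow_add hX]; ring_nf
  have hcoef : 0 ≤ q * (t / s) ^ (q - 1) := mul_nonneg (by linarith) (Real.rpow_nonneg hr _)
  have hyoung := rpow_tangent_line_le (mul_nonneg hr hX.le) (norm_nonneg y) h1q
  rw [Real.mul_rpow hr hX.le, Real.mul_rpow hr hX.le, hpow_one, hpow_two] at hyoung
  rw [hpow, mul_assoc]
  refine mul_le_mul_of_nonneg_left ?_ (Real.rpow_nonneg hX.le _)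
  calc ‖x‖ ^ (q - 2) *
        (q * (t / s) ^ (q - 1) * ⟪x, y⟫ - (q - 1) * (t / s) ^ q * ‖x‖ ^ (2 : ℝ))
      ≤ ‖x‖ ^ (q - 2) *
        (q * (t / s) ^ (q - 1) * (‖x‖ * ‖y‖) - (q - 1) * (t / s) ^ q * ‖x‖ ^ (2 : ℝ)) := by
        gcongr
        exact real_inner_le_norm x y
    _ = q * ((t / s) ^ (q - 1) * (‖x‖ ^ (q - 2) * ‖x‖)) * ‖y‖
        - (q - 1) * ((t / s) ^ q * (‖x‖ ^ (q - 2) * ‖x‖ ^ (2 : ℝ))) := by ring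
    _ ≤ ‖y‖ ^ q := hyoung
end

section
/- Let N ≥ 1 be an integer and let p, q be real numbers with 1 < q ≤ p. Then for all real numbers s, t ≥ 0 with s + t > 0 and all vectors X, Y ∈ ℝ^N, one has ‖ (1/2)·((s^q + t^q)/2)^{(1−q)/q} · ( s^{q−1}·X + t^{q−1}·Y ) ‖^p ≤ ( ‖X‖^p + ‖Y‖^p ) / 2. -/
/-- Hölder's inequality for the averages of two nonnegative numbers. -/
theorem mean_mul_le_Lp_mean_mul_Lq_mean {q r : ℝ} (hqr : q.HolderConjugate r)
    {x y a b : ℝ} (hx : 0 ≤ x) (hy : 0 ≤ y) (ha : 0 ≤ a) (hb : 0 ≤ b) :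
    (x * a + y * b) / 2 ≤ ((x ^ q + y ^ q) / 2) ^ (1 / q) * ((a ^ r + b ^ r) / 2) ^ (1 / r) := by
  have h := Real.inner_le_Lp_mul_Lq_of_nonneg (s := Finset.univ) (f := ![x, y]) (g := ![a, b]) hqr
    (by simp [Fin.forall_fin_two, hx, hy]) (by simp [Fin.forall_fin_two, ha, hb])
  simp only [Fin.sum_univ_two, Matrix.cons_val_zero, Matrix.cons_val_one] at h
  have h2 : (2 : ℝ) ^ (1 / q) * 2 ^ (1 / r) = 2 := by
    rw [← Real.rpow_add two_pos, one_div, one_div, hqr.inv_add_inv_eq_one, Real.rpow_one]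
  rw [Real.div_rpow (by positivity) zero_le_two, Real.div_rpow (by positivity) zero_le_two,
    div_mul_div_comm, h2]
  gcongr

/-- Monotonicity in the exponent of the power mean of two nonnegative numbers. -/
theorem power_mean_rpow_le {p q : ℝ} (hq : 0 < q) (hqp : q ≤ p) {x y : ℝ}
    (hx : 0 ≤ x) (hy : 0 ≤ y) :
    (((x ^ q + y ^ q) / 2) ^ (1 / q)) ^ p ≤ (x ^ p + y ^ p) / 2 := by
  have h := (convexOn_rpow ((one_le_div hq).2 hqp)).2
    (Set.mem_Ici.2 (Real.rpow_nonneg hx q)) (Set.mem_Ici.2 (Real.rpow_nonneg hy q))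
    (by norm_num : (0 : ℝ) ≤ 1 / 2) (by norm_num : (0 : ℝ) ≤ 1 / 2) (by norm_num)
  simp only [smul_eq_mul, one_div_mul_eq_div] at h
  rw [← Real.rpow_mul hx, ← Real.rpow_mul hy, mul_div_cancel₀ p hq.ne'] at h
  rw [← Real.rpow_mul (by positivity), one_div_mul_eq_div]
  rwa [add_div, add_div]

/-- Pointwise form of the hidden convexity inequality: for `1 < q ≤ p`, `s, t ≥ 0` with
`s + t > 0`, and vectors `X, Y`,
`‖(1/2)((s^q+t^q)/2)^{(1-q)/q} (s^{q-1} X + t^{q-1} Y)‖^p ≤ (‖X‖^p + ‖Y‖^p)/2`. -/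
theorem pointwise_hidden_convexity
    {N : ℕ} (hN : 1 ≤ N) (p q : ℝ) (h1q : 1 < q) (hqp : q ≤ p)
    (s t : ℝ) (hs : 0 ≤ s) (ht : 0 ≤ t) (hst : 0 < s + t)
    (X Y : EuclideanSpace ℝ (Fin N)) :
    ‖(1 / 2 * ((s ^ q + t ^ q) / 2) ^ ((1 - q) / q)) •
        (s ^ (q - 1) • X + t ^ (q - 1) • Y)‖ ^ p
      ≤ (‖X‖ ^ p + ‖Y‖ ^ p) / 2 := by
  have hq : 0 < q := by linarith
  have hqr : q.HolderConjugate (q / (q - 1)) := Real.HolderConjugate.conjExponent h1q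
  set M := (s ^ q + t ^ q) / 2 with hM
  have hM_pos : 0 < M := by
    rcases hs.eq_or_lt with rfl | hs'
    · have : 0 < t := by linarith
      positivity
    · positivity
  have h_rpow {z : ℝ} (hz : 0 ≤ z) : (z ^ (q - 1)) ^ (q / (q - 1)) = z ^ q := by
    rw [← Real.rpow_mul hz, mul_div_cancel₀ q (sub_pos.2 h1q).ne']
  have h_holder := mean_mul_le_Lp_mean_mul_Lq_mean hqr (norm_nonneg X) (norm_nonneg Y)
    (Real.rpow_nonneg hs (q - 1)) (Real.rpow_nonneg ht (q - 1))
  rw [h_rpow hs, h_rpow ht, ← hM] at h_holder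
  have h_cancel : M ^ ((1 - q) / q) * M ^ (1 / (q / (q - 1))) = 1 := by
    rw [← Real.rpow_add hM_pos, one_div_div, ← add_div, sub_add_sub_cancel, sub_self, zero_div,
      Real.rpow_zero]
  have h_norm : ‖(1 / 2 * M ^ ((1 - q) / q)) • (s ^ (q - 1) • X + t ^ (q - 1) • Y)‖
      ≤ ((‖X‖ ^ q + ‖Y‖ ^ q) / 2) ^ (1 / q) := by
    rw [norm_smul, Real.norm_of_nonneg (by positivity)]
    calc _ ≤ 1 / 2 * M ^ ((1 - q) / q) * (‖s ^ (q - 1) • X‖ + ‖t ^ (q - 1) • Y‖) := by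
          gcongr
          exact norm_add_le _ _
      _ = M ^ ((1 - q) / q) * ((‖X‖ * s ^ (q - 1) + ‖Y‖ * t ^ (q - 1)) / 2) := by
          rw [norm_smul, norm_smul, Real.norm_of_nonneg (by positivity),
            Real.norm_of_nonneg (by positivity)]
          ring
      _ ≤ M ^ ((1 - q) / q) *
          (((‖X‖ ^ q + ‖Y‖ ^ q) / 2) ^ (1 / q) * M ^ (1 / (q / (q - 1)))) := by
          gcongr
      _ = ((‖X‖ ^ q + ‖Y‖ ^ q) / 2) ^ (1 / q) := by
          rw [mul_left_comm, h_cancel, mul_one]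
  exact (Real.rpow_le_rpow (norm_nonneg _) h_norm (hq.le.trans hqp)).trans
    (power_mean_rpow_le hq hqp (norm_nonneg X) (norm_nonneg Y))
end
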